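/- Define σ²(x₁,x₂) = (p+q)(x₁² + x₂²)/2 − ((p−q)(x₁ + x₂)/2)². Then: (a) (S_n − n(p−q)(X_1 + X_2)/2) / √n converges in distribution, as n → ∞, to the mixture measure p(p+q)·N(0, p + q − (p−q)²) + r(p+q)·N(0, (p+q)/2 − ((p−q)/2)²) + q(p+q)·N(0, p+q) + r·δ_0; (b) (S_n − n(p−q)(X_1 + X_2)/2) / n → 0 almost surely as n → ∞; and (c) for almost every ω in the event {X_1² + X_2² ≠ 0}, limsup_{n→∞} (S_n − n(p−q)(X_1 + X_2)/2) / √(2 n log log n) = σ(X_1, X_2) and liminf_{n→∞} (S_n − n(p−q)(X_1 + X_2)/2) / √(2 n log log n) = −σ(X_1, X_2). -/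

import Mathlib

open MeasureTheory ProbabilityTheory Filter Real
open scoped ENNReal NNReal Topology Classical

noncomputable section

/-- The σ-algebra `σ(X_1, …, X_n)` generated by the first `n` steps. -/
def sigmaUpTo {Ω : Type*} (X : ℕ → Ω → ℝ) (n : ℕ) : MeasurableSpace Ω :=
  MeasurableSpace.comap (fun ω (k : Fin n) => X ((k : ℕ) + 1) ω) inferInstance

/-- Weak convergence of a sequence of measures on `ℝ` (convergence in distribution):
integrals of every bounded continuous function converge. -/
def TendstoInDist (μs : ℕ → Measure ℝ) (ν : Measure ℝ) : Prop :=
  ∀ f : BoundedContinuousFunction ℝ ℝ,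
    Tendsto (fun n => ∫ x, f x ∂(μs n)) atTop (𝓝 (∫ x, f x ∂ν))

set_option linter.unusedSectionVars false

/-- Bounded centered i.i.d. sequence with variance `v`. -/
structure BddIID {Ω : Type*} [MeasurableSpace Ω] (P : Measure Ω) (Y : ℕ → Ω → ℝ) (B v : ℝ) :
    Prop where
  meas : ∀ n, Measurable (Y n)
  indep : iIndepFun Y P
  ident : ∀ n, IdentDistrib (Y n) (Y 0) P P
  bdd : ∀ n ω, |Y n ω| ≤ B
  mean : ∫ ω, Y 0 ω ∂P = 0
  var : ∫ ω, (Y 0 ω) ^ 2 ∂P = v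
  Bpos : 0 < B
  vpos : 0 < v

namespace BddIID
variable {Ω : Type*} [MeasurableSpace Ω] {P : Measure Ω} [IsProbabilityMeasure P]
  {Y : ℕ → Ω → ℝ} {B v : ℝ}

lemma integrable_comp (h : BddIID P Y B v) (n : ℕ) (f : ℝ → ℝ) (hf : Continuous f) :
    Integrable (fun ω => f (Y n ω)) P := by
  obtain ⟨C, hC⟩ := (isCompact_Icc (a := -B) (b := B)).exists_bound_of_continuousOn hf.continuousOn
  refine Integrable.of_bound (hf.measurable.comp (h.meas n)).aestronglyMeasurable C ?_
  exact ae_of_all _ fun ω => hC _ ⟨(abs_le.1 (h.bdd n ω)).1, (abs_le.1 (h.bdd n ω)).2⟩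

lemma neg (h : BddIID P Y B v) : BddIID P (fun n ω => - Y n ω) B v where
  meas n := (h.meas n).neg
  indep := h.indep.comp (fun _ x => -x) (fun _ => measurable_neg)
  ident n := (h.ident n).comp measurable_neg
  bdd n ω := by rw [abs_neg]; exact h.bdd n ω
  mean := by rw [integral_neg, h.mean, neg_zero]
  var := by simp only [neg_sq]; exact h.var
  Bpos := h.Bpos
  vpos := h.vpos

lemma exp_cubic {x : ℝ} (hx : |x| ≤ 1) : exp x ≤ 1 + x + x ^ 2 / 2 + |x| ^ 3 := by
  have := Real.exp_bound hx (n := 3) (by norm_num)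
  have h2 := (abs_le.1 this).2
  simp only [Finset.sum_range_succ, Finset.sum_range_zero] at h2
  norm_num [Nat.factorial] at h2
  have : 0 ≤ |x| ^ 3 := by positivity
  nlinarith

lemma mgf_bound (h : BddIID P Y B v) {θ : ℝ} (hθ : 1 < θ) :
    ∃ l0 > 0, ∀ l, 0 ≤ l → l ≤ l0 → mgf (Y 0) P l ≤ exp (l ^ 2 * (v * θ) / 2) := by
  have hB := h.Bpos
  have hv := h.vpos
  refine ⟨min (1 / B) (v * (θ - 1) / (2 * B ^ 3)), ?_, fun l hl0 hl => ?_⟩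
  · have : 0 < θ - 1 := by linarith
    positivity
  have h1 : l * B ≤ 1 := by
    have := hl.trans (min_le_left _ _)
    rwa [le_div_iff₀ hB] at this
  have h2 : l * (2 * B ^ 3) ≤ v * (θ - 1) := by
    have := hl.trans (min_le_right _ _)
    rwa [le_div_iff₀ (by positivity)] at this
  have hpt : ∀ ω, exp (l * Y 0 ω) ≤ 1 + l * Y 0 ω + l ^ 2 / 2 * (Y 0 ω) ^ 2 + l ^ 3 * B ^ 3 := by
    intro ω
    have hb := h.bdd 0 ω
    have habs : |l * Y 0 ω| ≤ l * B := by
      rw [abs_mul, abs_of_nonneg hl0]; gcongr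
    have := exp_cubic (habs.trans h1)
    have h3 : |l * Y 0 ω| ^ 3 ≤ (l * B) ^ 3 := by gcongr
    have e1 : (l * Y 0 ω) ^ 2 / 2 = l ^ 2 / 2 * (Y 0 ω) ^ 2 := by ring
    have e2 : (l * B) ^ 3 = l ^ 3 * B ^ 3 := by ring
    linarith
  have i1 : Integrable (fun ω => Y 0 ω) P := h.integrable_comp 0 (fun x => x) continuous_id
  have i2 : Integrable (fun ω => (Y 0 ω) ^ 2) P := h.integrable_comp 0 (fun x => x ^ 2) (by fun_prop)
  have ie : Integrable (fun ω => exp (l * Y 0 ω)) P :=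
    h.integrable_comp 0 (fun x => exp (l * x)) (by fun_prop)
  have hInt : mgf (Y 0) P l ≤ 1 + l ^ 2 / 2 * v + l ^ 3 * B ^ 3 := by
    calc mgf (Y 0) P l = ∫ ω, exp (l * Y 0 ω) ∂P := rfl
      _ ≤ ∫ ω, (1 + l * Y 0 ω + l ^ 2 / 2 * (Y 0 ω) ^ 2 + l ^ 3 * B ^ 3) ∂P :=
        integral_mono ie (by fun_prop) hpt
      _ = 1 + l ^ 2 / 2 * v + l ^ 3 * B ^ 3 := by
        rw [integral_add (by fun_prop) (by fun_prop), integral_add (by fun_prop) (by fun_prop),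
          integral_add (by fun_prop) (by fun_prop), integral_const_mul, integral_const_mul,
          h.mean, h.var]
        simp
  calc mgf (Y 0) P l ≤ 1 + l ^ 2 / 2 * v + l ^ 3 * B ^ 3 := hInt
    _ ≤ l ^ 2 * (v * θ) / 2 + 1 := by nlinarith [sq_nonneg l]
    _ ≤ _ := Real.add_one_le_exp _

lemma one_le_mgf (h : BddIID P Y B v) (l : ℝ) : 1 ≤ mgf (Y 0) P l := by
  have i1 : Integrable (fun ω => Y 0 ω) P := h.integrable_comp 0 (fun x => x) continuous_id
  calc (1:ℝ) = ∫ ω, (l * Y 0 ω + 1) ∂P := by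
        rw [integral_add (by fun_prop) (by fun_prop), integral_const_mul, h.mean]; simp
    _ ≤ ∫ ω, exp (l * Y 0 ω) ∂P := by
        refine integral_mono (by fun_prop)
          (h.integrable_comp 0 (fun x => exp (l * x)) (by fun_prop)) fun ω => ?_
        exact Real.add_one_le_exp _

lemma measurable_sum (h : BddIID P Y B v) (s : Finset ℕ) : Measurable (fun ω => ∑ i ∈ s, Y i ω) :=
  Finset.measurable_sum _ fun i _ => h.meas i

lemma sum_bdd (h : BddIID P Y B v) (s : Finset ℕ) (ω : Ω) : |∑ i ∈ s, Y i ω| ≤ s.card * B := by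
  refine (Finset.abs_sum_le_sum_abs _ _).trans ?_
  refine (Finset.sum_le_sum fun i _ => h.bdd i ω).trans ?_
  simp

lemma integrable_exp_sum (h : BddIID P Y B v) (l : ℝ) (s : Finset ℕ) :
    Integrable (fun ω => exp (l * ∑ i ∈ s, Y i ω)) P := by
  refine Integrable.of_bound (C := exp (|l| * (s.card * B)))
    (Real.measurable_exp.comp ((h.measurable_sum s).const_mul l)).aestronglyMeasurable
    (ae_of_all _ fun ω => ?_)
  rw [Real.norm_eq_abs, abs_exp, exp_le_exp]
  refine (le_abs_self _).trans ?_
  rw [abs_mul]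
  gcongr
  exact h.sum_bdd s ω

lemma submart (h : BddIID P Y B v) (l : ℝ) :
    Submartingale (fun n ω => exp (l * ∑ i ∈ Finset.range (n + 1), Y i ω))
      (Filtration.natural Y fun i => (h.meas i).stronglyMeasurable) P := by
  set F := Filtration.natural Y fun i => (h.meas i).stronglyMeasurable with hF
  have hadap : ∀ n, StronglyMeasurable[F n] (fun ω => exp (l * ∑ i ∈ Finset.range (n + 1), Y i ω)) := by
    intro n
    have h1 : ∀ i ∈ Finset.range (n+1), Measurable[F n] (Y i) := by
      intro i hi
      have := (Filtration.stronglyAdapted_natural (fun i => (h.meas i).stronglyMeasurable) i)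
      exact (this.mono (F.mono (by simp at hi; omega))).measurable
    have h2 : Measurable[F n] (fun ω => ∑ i ∈ Finset.range (n + 1), Y i ω) :=
      Finset.measurable_sum _ h1
    exact (Real.measurable_exp.comp (h2.const_mul l)).stronglyMeasurable
  refine submartingale_nat hadap (fun n => h.integrable_exp_sum l _) fun n => ?_
  have hi : Integrable (fun ω => exp (l * Y (n+1) ω)) P :=
    h.integrable_comp _ (fun x => exp (l * x)) (by fun_prop)
  have heq : (fun ω => exp (l * ∑ i ∈ Finset.range (n + 1 + 1), Y i ω)) =
      (fun ω => exp (l * ∑ i ∈ Finset.range (n + 1), Y i ω)) * (fun ω => exp (l * Y (n+1) ω)) := by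
    ext ω
    rw [Finset.sum_range_succ, mul_add, exp_add]; rfl
  have hce : P[(fun ω => exp (l * Y (n+1) ω)) | F n] =ᵐ[P] fun _ => mgf (Y 0) P l := by
    have := condExp_indep_eq (h.meas (n+1)).comap_le (F.le n) (f := fun ω => exp (l * Y (n+1) ω))
      ?_ (h.indep.indep_comap_natural_of_lt (fun i => (h.meas i).stronglyMeasurable) (Nat.lt_succ_self n))
    · refine this.trans (ae_of_all _ fun _ => ?_)
      exact ((h.ident (n+1)).comp (u := fun x => exp (l * x)) (by fun_prop)).integral_eq
    · exact ((by fun_prop : Measurable fun x : ℝ => exp (l * x)).comp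
        (comap_measurable (Y (n+1)))).stronglyMeasurable
  rw [heq]
  have hmul := condExp_mul_of_stronglyMeasurable_left (hadap n)
    (heq ▸ h.integrable_exp_sum l _) hi
  filter_upwards [hmul, hce] with ω h1 h2
  rw [h1, Pi.mul_apply, h2]
  exact le_mul_of_one_le_right (exp_pos _).le (h.one_le_mgf l)

lemma integral_exp_sum (h : BddIID P Y B v) (l : ℝ) (n : ℕ) :
    ∫ ω, exp (l * ∑ i ∈ Finset.range n, Y i ω) ∂P = mgf (Y 0) P l ^ n := by
  have := h.indep.mgf_sum h.meas (Finset.range n) (t := l)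
  have h2 : ∀ i, mgf (Y i) P l = mgf (Y 0) P l := fun i =>
    ((h.ident i).comp (u := fun x => exp (l * x)) (by fun_prop)).integral_eq
  simp only [h2, Finset.prod_const, Finset.card_range] at this
  rw [← this]
  simp [mgf, Finset.sum_apply]

lemma maximal (h : BddIID P Y B v) {l : ℝ} (hl : 0 ≤ l) (x : ℝ) (N : ℕ) :
    P {ω | ∃ n, 1 ≤ n ∧ n ≤ N ∧ x ≤ ∑ i ∈ Finset.range n, Y i ω} ≤
      ENNReal.ofReal (exp (-(l * x)) * mgf (Y 0) P l ^ N) := by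
  rcases Nat.eq_zero_or_pos N with rfl | hN
  · refine le_of_eq_of_le ?_ bot_le
    rw [bot_eq_zero, ← measure_empty (μ := P)]
    congr 1
    refine Set.eq_empty_iff_forall_notMem.2 ?_
    rintro ω ⟨n, h1, h2, _⟩
    omega
  obtain ⟨N, rfl⟩ : ∃ M, N = M + 1 := ⟨N - 1, by omega⟩
  have key := maximal_ineq (h.submart l) (fun n ω => (exp_pos _).le)
    (ε := (exp (l * x)).toNNReal) N
  rw [Real.coe_toNNReal _ (exp_pos _).le] at key
  set A := {ω | exp (l * x) ≤
    (Finset.range (N + 1)).sup' Finset.nonempty_range_add_one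
      fun k => exp (l * ∑ i ∈ Finset.range (k + 1), Y i ω)} with hA
  have hsub : {ω | ∃ n, 1 ≤ n ∧ n ≤ N + 1 ∧ x ≤ ∑ i ∈ Finset.range n, Y i ω} ⊆ A := by
    rintro ω ⟨n, hn1, hn2, hx⟩
    rw [hA, Set.mem_ofPred_eq, Finset.le_sup'_iff]
    refine ⟨n - 1, by simp; omega, ?_⟩
    rw [Nat.sub_add_cancel hn1]
    exact exp_le_exp.2 (by gcongr)
  refine (measure_mono hsub).trans ?_
  have h3 : ∫ ω in A, exp (l * ∑ i ∈ Finset.range (N + 1), Y i ω) ∂P ≤ mgf (Y 0) P l ^ (N+1) := by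
    rw [← h.integral_exp_sum l (N+1)]
    exact setIntegral_le_integral (h.integrable_exp_sum l _) (ae_of_all _ fun ω => (exp_pos _).le)
  have h4 := key.trans (ENNReal.ofReal_le_ofReal h3)
  rw [exp_neg, ENNReal.ofReal_mul (by positivity), ENNReal.ofReal_inv_of_pos (exp_pos _)]
  change ENNReal.ofReal (exp (l * x)) * _ ≤ _ at h4
  rw [← ENNReal.div_eq_inv_mul]
  rw [ENNReal.le_div_iff_mul_le (by left; simp [exp_pos]) (by left; simp), mul_comm]
  exact h4

lemma tail (h : BddIID P Y B v) {θ : ℝ} (hθ : 1 < θ) :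
    ∃ l0 > 0, ∀ x M : ℝ, 0 ≤ x → 0 < M → x ≤ l0 * M →
      P {ω | ∃ n : ℕ, 1 ≤ n ∧ (n : ℝ) ≤ M ∧ x ≤ ∑ i ∈ Finset.range n, Y i ω} ≤
      ENNReal.ofReal (exp (-(x ^ 2 / (2 * M * (v * θ))))) := by
  obtain ⟨l0, hl0, H⟩ := h.mgf_bound hθ
  have hv := h.vpos
  have hvθ : 0 < v * θ := by positivity
  refine ⟨l0 * (v * θ), by positivity, fun x M hx hM hxM => ?_⟩
  set l := x / (M * (v * θ)) with hl
  have hl1 : 0 ≤ l := by positivity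
  have hl2 : l ≤ l0 := by
    rw [hl, div_le_iff₀ (by positivity)]; linarith
  have hs : {ω | ∃ n : ℕ, 1 ≤ n ∧ (n : ℝ) ≤ M ∧ x ≤ ∑ i ∈ Finset.range n, Y i ω} ⊆
      {ω | ∃ n, 1 ≤ n ∧ n ≤ ⌊M⌋₊ ∧ x ≤ ∑ i ∈ Finset.range n, Y i ω} := by
    rintro ω ⟨n, h1, h2, h3⟩
    exact ⟨n, h1, Nat.le_floor h2, h3⟩
  refine ((measure_mono hs).trans (h.maximal hl1 x _)).trans ?_
  apply ENNReal.ofReal_le_ofReal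
  have hN : ((⌊M⌋₊ : ℕ) : ℝ) ≤ M := Nat.floor_le hM.le
  calc exp (-(l * x)) * mgf (Y 0) P l ^ ⌊M⌋₊
      ≤ exp (-(l * x)) * exp (l ^ 2 * (v * θ) / 2) ^ ⌊M⌋₊ := by
        gcongr
        · exact mgf_nonneg
        · exact H l hl1 hl2
    _ = exp (-(l * x) + ⌊M⌋₊ * (l ^ 2 * (v * θ) / 2)) := by
        rw [← exp_nat_mul, ← exp_add]
    _ ≤ exp (-(l * x) + M * (l ^ 2 * (v * θ) / 2)) := by gcongr
    _ = _ := by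
        congr 1
        rw [hl]; field_simp; ring

end BddIID

/-- The LIL normalization. -/
def lilphi (x : ℝ) : ℝ := Real.sqrt (2 * x * Real.log (Real.log x))

lemma lilphi_nonneg (x : ℝ) : 0 ≤ lilphi x := Real.sqrt_nonneg _

lemma one_le_log {x : ℝ} (hx : exp 1 ≤ x) : 1 ≤ log x := by
  rwa [Real.le_log_iff_exp_le (lt_of_lt_of_le (exp_pos _) hx)]

lemma lilphi_sq {x : ℝ} (hx : exp 1 ≤ x) : lilphi x ^ 2 = 2 * x * log (log x) := by
  have h0 : 0 < x := lt_of_lt_of_le (exp_pos _) hx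
  have h2 := Real.log_nonneg (one_le_log hx)
  rw [lilphi, Real.sq_sqrt (by positivity)]

lemma lilphi_mono {x y : ℝ} (hx : exp 1 ≤ x) (hxy : x ≤ y) : lilphi x ≤ lilphi y := by
  have h0 : 0 < x := lt_of_lt_of_le (exp_pos _) hx
  have h1 := one_le_log hx
  have h2 := Real.log_nonneg h1
  have hy : 0 < y := h0.trans_le hxy
  unfold lilphi
  gcongr

lemma tendsto_lilphi : Tendsto (fun n : ℕ => lilphi n) atTop atTop := by
  unfold lilphi
  refine Real.tendsto_sqrt_atTop.comp ?_
  refine Tendsto.atTop_mul_atTop₀ ?_ ?_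
  · exact tendsto_natCast_atTop_atTop.const_mul_atTop (by norm_num)
  · exact Real.tendsto_log_atTop.comp (Real.tendsto_log_atTop.comp tendsto_natCast_atTop_atTop)

lemma eventually_log_small {θ L K : ℝ} (hθ : 1 < θ) (hL : 0 < L) (hK : 0 < K) :
    ∀ᶠ k : ℕ in atTop, K * log (k * L) ≤ θ ^ k := by
  have h := tendsto_self_mul_const_pow_of_lt_one (r := θ⁻¹) (by positivity) (inv_lt_one_of_one_lt₀ hθ)
  have h2 := h.eventually (gt_mem_nhds (show (0:ℝ) < 1 / (K * L) by positivity))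
  filter_upwards [h2, eventually_gt_atTop 0] with k hk hk0
  have hθk : 0 < θ ^ k := by positivity
  rw [inv_pow, ← div_eq_mul_inv, div_lt_div_iff₀ hθk (by positivity)] at hk
  have hk0' : (0:ℝ) < k := by exact_mod_cast hk0
  have : log (k * L) ≤ k * L := (Real.log_le_sub_one_of_pos (by positivity)).trans (by linarith)
  nlinarith

namespace BddIID
variable {Ω : Type*} [MeasurableSpace Ω] {P : Measure Ω} [IsProbabilityMeasure P]
  {Y : ℕ → Ω → ℝ} {B v : ℝ}

lemma upper (h : BddIID P Y B v) {c : ℝ} (hc : 1 < c) :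
    ∀ᵐ ω ∂P, ∀ᶠ n : ℕ in atTop, ∑ i ∈ Finset.range n, Y i ω ≤ c * Real.sqrt v * lilphi n := by
  have hv := h.vpos
  obtain ⟨θ, hθ, hcθ⟩ : ∃ θ : ℝ, 1 < θ ∧ c = θ ^ 2 :=
    ⟨√c, by rw [Real.lt_sqrt (by norm_num)]; linarith, (Real.sq_sqrt (by linarith)).symm⟩
  obtain ⟨l0, hl0, H⟩ := h.tail hθ
  have hL : 0 < log θ := Real.log_pos hθ
  set x : ℕ → ℝ := fun k => c * √v * lilphi (θ ^ k) with hx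
  have hx0 : ∀ k, 0 ≤ x k := fun k => by
    have := lilphi_nonneg (θ ^ k)
    have : 0 ≤ c := by linarith
    positivity
  have hxs : ∀ k, exp 1 ≤ θ ^ k → x k ^ 2 = θ ^ 4 * v * (2 * θ ^ k * log (k * log θ)) := by
    intro k hk
    rw [hx]; simp only
    rw [mul_pow, mul_pow, lilphi_sq hk, Real.sq_sqrt hv.le, Real.log_pow, hcθ]; ring
  have hpow : Tendsto (fun k : ℕ => θ ^ k) atTop atTop := tendsto_pow_atTop_atTop_of_one_lt hθ
  have hev : ∀ᶠ k : ℕ in atTop, exp 1 ≤ θ ^ k ∧ x k ≤ l0 * θ ^ (k + 1) ∧ 0 < k := by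
    filter_upwards [hpow.eventually_ge_atTop (exp 1), eventually_gt_atTop 0,
      eventually_log_small hθ hL (show 0 < θ ^ 4 * v * 2 / (l0 ^ 2 * θ ^ 2) by positivity)]
      with k h1 h2 h3
    refine ⟨h1, ?_, h2⟩
    refine abs_le_of_sq_le_sq' ?_ (by positivity) |>.2
    rw [hxs k h1]
    rw [div_mul_eq_mul_div, div_le_iff₀ (by positivity)] at h3
    have : 0 < θ ^ k := by positivity
    calc θ ^ 4 * v * (2 * θ ^ k * log (k * log θ)) = θ ^ k * (θ ^ 4 * v * 2 * log (k * log θ)) := by ring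
      _ ≤ θ ^ k * (θ ^ k * (l0 ^ 2 * θ ^ 2)) := by gcongr
      _ = (l0 * θ ^ (k + 1)) ^ 2 := by ring
  obtain ⟨k0, hk0⟩ := eventually_atTop.1 hev
  set s : ℕ → Set Ω := fun k =>
    {ω | ∃ n : ℕ, 1 ≤ n ∧ (n : ℝ) ≤ θ ^ (k + 1) ∧ x k ≤ ∑ i ∈ Finset.range n, Y i ω} with hs
  have hPs : ∀ k, k0 ≤ k → P (s k) ≤ ENNReal.ofReal ((log θ) ^ (-θ ^ 2) * (1 / (k : ℝ) ^ (θ ^ 2))) := by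
    intro k hk
    obtain ⟨h1, h2, h3⟩ := hk0 k hk
    have h3' : (0:ℝ) < k := by exact_mod_cast h3
    refine (H (x k) (θ ^ (k+1)) (hx0 k) (by positivity) h2).trans ?_
    apply ENNReal.ofReal_le_ofReal
    apply le_of_eq
    rw [hxs k h1]
    have : θ ^ 4 * v * (2 * θ ^ k * log (k * log θ)) / (2 * θ ^ (k + 1) * (v * θ))
        = log (k * log θ) * θ ^ 2 := by
      field_simp
      ring
    rw [this, one_div, ← Real.rpow_neg h3'.le, ← Real.mul_rpow hL.le h3'.le,
      Real.rpow_def_of_pos (by positivity), mul_comm (log θ)]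
    ring_nf
  have hsum : ∑' k, P (s (k + k0)) ≠ ∞ := by
    have hsm : Summable (fun k : ℕ => (log θ) ^ (-θ ^ 2) * (1 / (k : ℝ) ^ (θ ^ 2))) :=
      (Real.summable_one_div_nat_rpow.2 (by nlinarith)).mul_left _
    have hsm2 := (summable_nat_add_iff k0).2 hsm
    refine ne_top_of_le_ne_top ?_ (ENNReal.tsum_le_tsum fun k => hPs (k + k0) (by omega))
    exact hsm2.tsum_ofReal_ne_top
  filter_upwards [ae_eventually_notMem hsum] with ω hω
  obtain ⟨k1, hk1⟩ := eventually_atTop.1 hω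
  filter_upwards [tendsto_natCast_atTop_atTop.eventually_ge_atTop (θ ^ (k0 + k1)),
    eventually_ge_atTop 1] with n hn hn1
  obtain ⟨k, hka, hkb⟩ := exists_nat_pow_near (show (1:ℝ) ≤ n by exact_mod_cast hn1) hθ
  have hk : k0 + k1 < k + 1 := (pow_lt_pow_iff_right₀ hθ).1 (hn.trans_lt hkb)
  obtain ⟨j, rfl⟩ : ∃ j, k = j + k0 := ⟨k - k0, by omega⟩
  have hnot := hk1 j (by omega)
  have hlt : ∑ i ∈ Finset.range n, Y i ω < x (j + k0) := by
    by_contra hcon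
    exact hnot ⟨n, hn1, hkb.le, not_lt.1 hcon⟩
  refine hlt.le.trans ?_
  have h1 := (hk0 (j + k0) (by omega)).1
  rw [hx]
  have : 0 ≤ c := by linarith
  have := lilphi_mono h1 hka
  simp only
  gcongr

end BddIID

lemma gaussian_tail_lower {t : ℝ} (ht : 0 ≤ t) :
    ENNReal.ofReal (exp (-((t + 1) ^ 2 / 2 + 2))) < gaussianReal 0 1 (Set.Ioi t) := by
  have h1 : ENNReal.ofReal ((√(2 * π))⁻¹ * exp (-((t + 1) ^ 2 / 2))) ≤ gaussianReal 0 1 (Set.Ioi t) := by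
    calc ENNReal.ofReal ((√(2 * π))⁻¹ * exp (-((t + 1) ^ 2 / 2)))
        = ∫⁻ x in Set.Ioc t (t+1), ENNReal.ofReal ((√(2 * π))⁻¹ * exp (-((t + 1) ^ 2 / 2))) := by
          simp
      _ ≤ ∫⁻ x in Set.Ioc t (t+1), gaussianPDF 0 1 x := by
          refine setLIntegral_mono (measurable_gaussianPDF 0 1) fun x hx => ?_
          rw [gaussianPDF]
          apply ENNReal.ofReal_le_ofReal
          rw [gaussianPDFReal]
          simp only [NNReal.coe_one, mul_one, sub_zero]
          gcongr
          rw [neg_div, neg_le_neg_iff]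
          have := hx.1
          have := hx.2
          nlinarith
      _ = gaussianReal 0 1 (Set.Ioc t (t+1)) := by
          rw [gaussianReal_apply _ (by norm_num)]
      _ ≤ _ := measure_mono fun x hx => hx.1
  refine lt_of_lt_of_le ?_ h1
  rw [ENNReal.ofReal_lt_ofReal_iff (by positivity), neg_add, exp_add, mul_comm]
  gcongr
  rw [exp_neg]
  have hpi := Real.pi_lt_d2
  have : √(2 * π) < 3 := by
    rw [Real.sqrt_lt' (by norm_num)]; nlinarith
  have h2 : (3:ℝ) ≤ exp 2 := by have := Real.add_one_le_exp 2; linarith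
  have h0 : 0 < √(2 * π) := by positivity
  gcongr
  linarith

namespace BddIID
variable {Ω : Type*} [MeasurableSpace Ω] {P : Measure Ω} [IsProbabilityMeasure P]
  {Y : ℕ → Ω → ℝ} {B v : ℝ}

lemma tail_lower (h : BddIID P Y B v) {t : ℝ} (ht : 0 ≤ t) :
    ∀ᶠ m : ℕ in atTop, ENNReal.ofReal (exp (-((t + 1) ^ 2 / 2 + 2))) ≤
      P {ω | t * (√v * √m) ≤ ∑ i ∈ Finset.range m, Y i ω} := by
  have hv := h.vpos
  have hsv : 0 < √v := Real.sqrt_pos.2 hv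
  have key := tendstoInDistribution_inv_sqrt_mul_sum (P := P) (P' := gaussianReal 0 1)
    (X := fun k ω => Y k ω / √v) (Y := id) HasLaw.id ?_ ?_ ?_ ?_
  rotate_left
  · rw [integral_div, h.mean, zero_div]
  · simp only [Pi.pow_apply, div_pow]
    rw [integral_div, h.var, Real.sq_sqrt hv.le, div_self hv.ne']
  · exact h.indep.comp (fun _ x => x / √v) (by fun_prop)
  · exact fun n => (h.ident n).comp (u := fun x => x / √v) (by fun_prop)
  have hl := ProbabilityMeasure.le_liminf_measure_open_of_tendsto key.tendsto (isOpen_Ioi (a := t))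
  have hlt := lt_of_lt_of_le (gaussian_tail_lower ht) (by simpa using hl)
  filter_upwards [eventually_lt_of_lt_liminf hlt, eventually_gt_atTop 0] with m hm hm0
  refine hm.le.trans ?_
  have hsm : 0 < √(m:ℝ) := Real.sqrt_pos.2 (by exact_mod_cast hm0)
  rw [Measure.map_apply_of_aemeasurable (key.forall_aemeasurable m) measurableSet_Ioi]
  refine measure_mono fun ω hω => ?_
  simp only [Set.mem_preimage, Set.mem_Ioi, ← Finset.sum_div] at hω
  rw [inv_mul_eq_div, div_div, lt_div_iff₀ (by positivity)] at hω
  exact hω.le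

lemma indep_Ico (h : BddIID P Y B v) (a b c : ℕ) :
    IndepFun (fun ω => ∑ i ∈ Finset.Ico a b, Y i ω) (fun ω => ∑ i ∈ Finset.Ico b c, Y i ω) P := by
  have := (h.indep.indepFun_finset (Finset.Ico a b) (Finset.Ico b c)
    (Finset.Ico_disjoint_Ico_consecutive a b c) h.meas).comp
    (φ := fun f => ∑ i, f i) (ψ := fun f => ∑ i, f i) (by fun_prop) (by fun_prop)
  convert this using 1
  · ext ω; simp only [Function.comp]
    exact (Finset.sum_coe_sort (Finset.Ico a b) (fun i => Y i ω)).symm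
  · ext ω; simp only [Function.comp]
    exact (Finset.sum_coe_sort (Finset.Ico b c) (fun i => Y i ω)).symm

lemma shift (h : BddIID P Y B v) (a m : ℕ) (y : ℝ) :
    P {ω | y ≤ ∑ i ∈ Finset.Ico a (a + m), Y i ω} = P {ω | y ≤ ∑ i ∈ Finset.range m, Y i ω} := by
  have h1 := IdentDistrib.pi (X := fun i => Y (a + i)) (Y := Y) (μ := P) (ν := P)
    (fun i => (h.ident _).trans (h.ident i).symm)
    (h.indep.precomp (add_right_injective a)) h.indep
  have h2 := h1.comp (u := fun f => ∑ i ∈ Finset.range m, f i) (by fun_prop)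
  have h3 := h2.measure_mem_eq (measurableSet_Ici (a := y))
  convert h3 using 2
  · ext ω
    simp [Finset.sum_Ico_eq_sum_range]
  · rfl

lemma block (h : BddIID P Y B v) (a m : ℕ) (y : ℝ) (L : ℕ) :
    P {ω | y ≤ ∑ i ∈ Finset.range m, Y i ω} ^ L ≤
      P {ω | L * y ≤ ∑ i ∈ Finset.Ico a (a + L * m), Y i ω} := by
  induction L with
  | zero => simp
  | succ L ih =>
    rw [pow_succ]
    have hind := (h.indep_Ico a (a + L * m) (a + L * m + m)).measure_inter_preimage_eq_mul
      (Set.Ici (L * y)) (Set.Ici y) measurableSet_Ici measurableSet_Ici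
    have e2 := h.shift (a + L * m) m y
    calc _ ≤ P {ω | L * y ≤ ∑ i ∈ Finset.Ico a (a + L * m), Y i ω} *
          P {ω | y ≤ ∑ i ∈ Finset.Ico (a + L * m) (a + L * m + m), Y i ω} := by
          rw [e2]; gcongr
      _ = _ := hind.symm
      _ ≤ _ := by
          refine measure_mono ?_
          rintro ω ⟨h1, h2⟩
          simp only [Set.mem_preimage, Set.mem_Ici] at h1 h2
          rw [Set.mem_ofPred_eq, show a + (L + 1) * m = a + L * m + m by ring,
            ← Finset.sum_Ico_consecutive _ (show a ≤ a + L * m by omega)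
              (show a + L * m ≤ a + L * m + m by omega)]
          push_cast
          linarith

lemma indepSets (h : BddIID P Y B v) (nn : ℕ → ℕ) (hnn : Monotone nn) (c : ℕ → ℝ) :
    iIndepSet (fun k => {ω | c k ≤ ∑ i ∈ Finset.Ico (nn k) (nn (k + 1)), Y i ω}) P := by
  set s := fun k => {ω | c k ≤ ∑ i ∈ Finset.Ico (nn k) (nn (k + 1)), Y i ω} with hs
  have hgen : ∀ (I : Set ℕ) k, (∀ i, nn k ≤ i → i < nn (k+1) → i ∈ I) →
      MeasurableSet[⨆ i ∈ I, MeasurableSpace.comap (Y i) inferInstance] (s k) := by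
    intro I k hI
    have h1 : ∀ i ∈ Finset.Ico (nn k) (nn (k+1)),
        Measurable[⨆ i ∈ I, MeasurableSpace.comap (Y i) inferInstance] (Y i) := by
      intro i hi
      rw [Finset.mem_Ico] at hi
      exact (comap_measurable (Y i)).mono
        (le_iSup₂ (f := fun i _ => MeasurableSpace.comap (Y i) inferInstance) i (hI i hi.1 hi.2)) le_rfl
    exact (Finset.measurable_sum _ h1) measurableSet_Ici
  have hle : ∀ i, MeasurableSpace.comap (Y i) inferInstance ≤ (inferInstance : MeasurableSpace Ω) :=
    fun i => (h.meas i).comap_le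
  rw [iIndepSet_iff_meas_biInter]
  swap
  · intro k
    exact measurableSet_le measurable_const (h.measurable_sum _)
  intro S
  induction S using Finset.induction_on_max with
  | empty => simp
  | insert a S hS ih =>
    have hna : a ∉ S := fun ha => lt_irrefl _ (hS a ha)
    rw [Finset.prod_insert hna, ← ih, Finset.set_biInter_insert]
    have hind := indep_iSup_of_disjoint hle h.indep.iIndep
      (S := Set.Ici (nn a)) (T := Set.Iio (nn a))
      (by rw [Set.disjoint_left]; intro x hx hx2; simp at hx hx2; omega)
    refine (Indep_iff _ _ _).1 hind _ _ (hgen _ a fun i hi _ => hi) ?_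
    refine Finset.measurableSet_biInter _ fun k hk => hgen _ k fun i _ hi => ?_
    exact lt_of_lt_of_le hi (hnn (hS k hk))

end BddIID

/-- Cost exponent of one block. -/
def lkap (N : ℕ) : ℝ := ((N : ℝ) + 1) ^ 2 / 2 + 2

/-- Number of blocks. -/
def lL (N k : ℕ) : ℕ := ⌊log k / lkap N⌋₊

/-- Endpoints. -/
def lnn (N k : ℕ) : ℕ := ∑ j ∈ Finset.range k, lL N j * N ^ j

/-- Auxiliary constant. -/
def lG (R : ℝ) : ℝ := R ^ 2 / ((R + 1) ^ 2 + 4) * ((1 - 1 / R) / (1 + 1 / R)) * ((R - 1) / R)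

lemma lkap_pos (N : ℕ) : 0 < lkap N := by unfold lkap; positivity

lemma lkap_one (N : ℕ) : 1 ≤ lkap N := by
  unfold lkap
  have : 0 ≤ ((N : ℝ) + 1) ^ 2 / 2 := by positivity
  linarith

lemma lL_mono (N k : ℕ) : lL N k ≤ lL N (k + 1) := by
  have := lkap_pos N
  unfold lL
  apply Nat.floor_mono
  refine div_le_div_of_nonneg_right ?_ this.le
  rcases Nat.eq_zero_or_pos k with rfl | hk
  · simp
  · apply Real.log_le_log (by exact_mod_cast hk)
    push_cast; linarith

lemma lL_le (N k : ℕ) : (lL N k : ℝ) ≤ log k / lkap N := by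
  unfold lL
  refine Nat.floor_le ?_
  exact div_nonneg (Real.log_natCast_nonneg k) (lkap_pos N).le

lemma lL_le_self (N k : ℕ) : (lL N k : ℝ) ≤ k := by
  refine (lL_le N k).trans ?_
  rw [div_le_iff₀ (lkap_pos N)]
  rcases Nat.eq_zero_or_pos k with rfl | hk
  · simp
  have hk' : (0:ℝ) < k := by exact_mod_cast hk
  have := Real.log_le_sub_one_of_pos hk'
  have := lkap_one N
  nlinarith

lemma lnn_succ (N k : ℕ) : lnn N (k + 1) = lnn N k + lL N k * N ^ k := by
  unfold lnn; rw [Finset.sum_range_succ]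

lemma lnn_mono (N : ℕ) : Monotone (lnn N) :=
  monotone_nat_of_le_succ fun k => by rw [lnn_succ]; omega

lemma lnn_F1 (N k : ℕ) : N * lnn N (k + 1) ≤ lL N k * N ^ (k + 1) + lnn N (k + 1) := by
  induction k with
  | zero => simp [lnn]; nlinarith
  | succ k ih =>
    rw [lnn_succ N (k+1)]
    have := Nat.mul_le_mul_right (N ^ (k+1)) (lL_mono N k)
    have e : N * (lnn N (k + 1) + lL N (k + 1) * N ^ (k + 1)) =
      N * lnn N (k+1) + lL N (k+1) * N ^ (k + 1 + 1) := by ring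
    omega

lemma lnn_F2 (N k : ℕ) : N * lnn N k ≤ lnn N (k + 1) := by
  induction k with
  | zero => simp [lnn]
  | succ k ih =>
    rw [lnn_succ N (k+1)]
    have := Nat.mul_le_mul_right (N ^ (k+1)) (lL_mono N k)
    have e : N * lnn N (k + 1) = N * lnn N k + lL N k * N ^ (k+1) := by rw [lnn_succ]; ring
    omega

lemma tendsto_lL (N : ℕ) : Tendsto (fun k => lL N k) atTop atTop := by
  unfold lL
  refine tendsto_nat_floor_atTop.comp ?_
  exact (Real.tendsto_log_atTop.comp tendsto_natCast_atTop_atTop).atTop_div_const (lkap_pos N)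

lemma tendsto_lnn {N : ℕ} (hN : 2 ≤ N) : Tendsto (fun k => lnn N k) atTop atTop := by
  rw [← tendsto_add_atTop_iff_nat 1]
  refine tendsto_atTop_mono (fun k => ?_) (tendsto_lL N)
  rw [lnn_succ]
  have : 0 < N ^ k := by positivity
  nlinarith

lemma lnn_le_pow {N k : ℕ} (hN : 2 ≤ N) (hk : 1 ≤ k) : lnn N (k + 1) ≤ N ^ (3 * k) := by
  have h1 := lnn_F1 N k
  have hL : lL N k ≤ k := by exact_mod_cast lL_le_self N k
  have hk2 : k < 2 ^ k := Nat.lt_two_pow_self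
  have hk3 : 2 ^ k ≤ N ^ k := Nat.pow_le_pow_left hN k
  -- nn ≤ L N^{k+1}
  have h2 : lnn N (k+1) ≤ lL N k * N ^ (k + 1) := by
    have : 2 * lnn N (k+1) ≤ N * lnn N (k+1) := Nat.mul_le_mul_right _ hN
    omega
  calc lnn N (k+1) ≤ lL N k * N ^ (k+1) := h2
    _ ≤ N ^ k * N ^ (k + 1) := Nat.mul_le_mul_right _ (by omega)
    _ = N ^ (k + (k + 1)) := by ring
    _ ≤ N ^ (3 * k) := Nat.pow_le_pow_right (by omega) (by omega)

lemma eventually_loglog {N : ℕ} (hN : 2 ≤ N) :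
    ∀ᶠ k : ℕ in atTop, log (log (lnn N (k + 1))) ≤ (1 + 1 / (N:ℝ)) * log k := by
  have hN0 : (0:ℝ) < N := by positivity
  have hN1 : (1:ℝ) < N := by exact_mod_cast hN
  have ht : Tendsto (fun k : ℕ => log (k:ℝ)) atTop atTop :=
    Real.tendsto_log_atTop.comp tendsto_natCast_atTop_atTop
  have ht2 := ((tendsto_lnn hN).comp (tendsto_add_atTop_nat 1))
  filter_upwards [eventually_ge_atTop 1, ht.eventually_ge_atTop (N * log (3 * log N)),
    ht2.eventually_ge_atTop 2] with k hk hk2 hk3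
  simp only [Function.comp] at hk3
  have hn1 : (1:ℝ) < lnn N (k+1) := by exact_mod_cast hk3
  have hn0 : (0:ℝ) < lnn N (k+1) := by linarith
  have hlN : 0 < log (N:ℝ) := Real.log_pos hN1
  have hk0 : (0:ℝ) < k := by exact_mod_cast hk
  have a : log (lnn N (k+1)) ≤ k * (3 * log N) := by
    have : (lnn N (k+1) : ℝ) ≤ (N:ℝ) ^ (3 * k) := by exact_mod_cast lnn_le_pow hN hk
    have := Real.log_le_log hn0 this
    rw [Real.log_pow] at this
    push_cast at this; linarith
  have b := Real.log_le_log (Real.log_pos hn1) a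
  rw [Real.log_mul hk0.ne' (by positivity)] at b
  have : log (3 * log N) ≤ 1 / N * log k := by
    rw [one_div, inv_mul_eq_div, le_div_iff₀ hN0]; linarith
  linarith

lemma eventually_lL {N : ℕ} (hN : 2 ≤ N) :
    ∀ᶠ k : ℕ in atTop, (1 - 1 / (N:ℝ)) * log k ≤ lkap N * lL N k := by
  have hN0 : (0:ℝ) < N := by positivity
  have hκ := lkap_pos N
  have ht : Tendsto (fun k : ℕ => log (k:ℝ)) atTop atTop :=
    Real.tendsto_log_atTop.comp tendsto_natCast_atTop_atTop
  filter_upwards [ht.eventually_ge_atTop (N * lkap N)] with k hk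
  have := Nat.lt_floor_add_one (log k / lkap N)
  rw [div_lt_iff₀ hκ] at this
  change log k < ((lL N k : ℝ) + 1) * lkap N at this
  have h2 : lkap N ≤ 1 / N * log k := by
    rw [one_div, inv_mul_eq_div, le_div_iff₀ hN0]; linarith
  linarith

lemma key_det {N : ℕ} (hN : 2 ≤ N) : ∀ᶠ k : ℕ in atTop,
    √(lG N) * lilphi (lnn N (k + 1)) ≤ lL N k * (N * √((N ^ k : ℕ) : ℝ)) := by
  have hN0 : (0:ℝ) < N := by positivity
  have hN1 : (1:ℝ) < N := by exact_mod_cast hN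
  have hκ := lkap_pos N
  have ht2 := tendsto_natCast_atTop_atTop (R := ℝ).comp
    ((tendsto_lnn hN).comp (tendsto_add_atTop_nat 1))
  filter_upwards [eventually_loglog hN, eventually_lL hN, ht2.eventually_ge_atTop (exp 1),
    eventually_ge_atTop 1] with k h1 h2 h3 h4
  simp only [Function.comp] at h3
  have hlk : 0 ≤ log (k:ℝ) := Real.log_natCast_nonneg k
  have hG : 0 ≤ lG N := by
    unfold lG
    have : 0 ≤ 1 - 1 / (N:ℝ) := by
      rw [sub_nonneg, div_le_one hN0]; exact hN1.le
    have : 0 ≤ (N:ℝ) - 1 := by linarith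
    positivity
  refine abs_le_of_sq_le_sq' ?_ (by positivity) |>.2
  rw [mul_pow, Real.sq_sqrt hG, lilphi_sq h3, mul_pow, mul_pow, Real.sq_sqrt (by positivity)]
  have hF : ((N:ℝ) - 1) * lnn N (k+1) ≤ lL N k * N ^ (k+1) := by
    have : (N:ℝ) * lnn N (k + 1) ≤ lL N k * N ^ (k + 1) + lnn N (k + 1) := by
      exact_mod_cast lnn_F1 N k
    linarith
  set n : ℝ := (lnn N (k+1) : ℝ) with hn
  set L : ℝ := (lL N k : ℝ) with hL
  set R : ℝ := (N : ℝ) with hR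
  have hn0 : 0 < n := lt_of_lt_of_le (exp_pos 1) h3
  have hκ2 : (R + 1) ^ 2 + 4 = 2 * lkap N := by unfold lkap; ring
  have hR1 : 0 < R - 1 := by linarith
  have hl2 : 0 ≤ (1 + 1 / R) * log k := by positivity
  have hnb : n ≤ L * R ^ (k+1) / (R - 1) := by
    rw [le_div_iff₀ hR1]; linarith
  have h1R : 0 ≤ 1 - 1 / R := by
      rw [sub_nonneg, div_le_one hN0]; exact hN1.le
  calc lG R * (2 * n * log (log n))
      ≤ lG R * (2 * n * ((1 + 1 / R) * log k)) := by gcongr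
    _ ≤ lG R * (2 * (L * R ^ (k+1) / (R - 1)) * ((1 + 1 / R) * log k)) := by gcongr
    _ = R ^ 2 * R ^ k * L / lkap N * ((1 - 1 / R) * log k) := by
        unfold lG
        rw [hκ2]
        have : R + 1 ≠ 0 := by positivity
        have := hR1.ne'
        field_simp
        ring
    _ ≤ R ^ 2 * R ^ k * L / lkap N * (lkap N * L) := by gcongr
    _ = L ^ 2 * (R ^ 2 * ((N ^ k : ℕ) : ℝ)) := by
        push_cast
        rw [← hR]
        field_simp

lemma tendsto_lG : Tendsto (fun N : ℕ => √(lG N) - 2 / √(N:ℝ)) atTop (𝓝 1) := by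
  have hcast : Tendsto (fun N : ℕ => (N:ℝ)) atTop atTop := tendsto_natCast_atTop_atTop
  have hinv : Tendsto (fun N : ℕ => 1 / (N:ℝ)) atTop (𝓝 0) := by
    exact tendsto_one_div_atTop_nhds_zero_nat
  have h1 : Tendsto (fun N : ℕ => 1 / ((1 + 1 / (N:ℝ)) ^ 2 + 4 * (1 / (N:ℝ)) ^ 2) *
      ((1 - 1 / (N:ℝ)) / (1 + 1 / (N:ℝ))) * (1 - 1 / (N:ℝ))) atTop
      (𝓝 (1 / ((1 + 0) ^ 2 + 4 * 0 ^ 2) * ((1 - 0) / (1 + 0)) * (1 - 0))) := by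
    refine Tendsto.mul (Tendsto.mul ?_ ?_) ?_
    · refine Tendsto.div tendsto_const_nhds ?_ (by norm_num)
      exact ((hinv.const_add 1).pow 2).add ((hinv.pow 2).const_mul 4)
    · exact Tendsto.div (hinv.const_sub 1) (hinv.const_add 1) (by norm_num)
    · exact hinv.const_sub 1
  have h2 : Tendsto (fun N : ℕ => lG N) atTop (𝓝 1) := by
    norm_num at h1
    refine h1.congr' ?_
    filter_upwards [eventually_gt_atTop 0] with N hN
    have : (0:ℝ) < N := by exact_mod_cast hN
    unfold lG
    field_simp
  have h3 : Tendsto (fun N : ℕ => 2 / √(N:ℝ)) atTop (𝓝 0) :=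
    Tendsto.const_div_atTop (Real.tendsto_sqrt_atTop.comp hcast) 2
  simpa using h2.sqrt.sub h3

namespace BddIID
variable {Ω : Type*} [MeasurableSpace Ω] {P : Measure Ω} [IsProbabilityMeasure P]
  {Y : ℕ → Ω → ℝ} {B v : ℝ}

lemma lower_aux (h : BddIID P Y B v) {N : ℕ} (hN : 2 ≤ N) :
    ∀ᵐ ω ∂P, ∃ᶠ n : ℕ in atTop,
      (√(lG N) - 2 / √(N:ℝ)) * √v * lilphi n ≤ ∑ i ∈ Finset.range n, Y i ω := by
  have hv := h.vpos
  have hN0 : (0:ℝ) < N := by positivity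
  have hN1 : 1 < N := hN
  have hκ := lkap_pos N
  set c : ℕ → ℝ := fun k => lL N k * (N * (√v * √((N ^ k : ℕ) : ℝ))) with hc
  set s := fun k => {ω | c k ≤ ∑ i ∈ Finset.Ico (lnn N k) (lnn N (k + 1)), Y i ω} with hs
  have hms : ∀ k, MeasurableSet (s k) := fun k =>
    measurableSet_le measurable_const (h.measurable_sum _)
  have hind : iIndepSet s P := h.indepSets (lnn N) (lnn_mono N) c
  have hP : ∀ᶠ k : ℕ in atTop, 1 / (k:ℝ) ≤ (P (s k)).toReal := by
    have htail := (h.tail_lower (t := N) hN0.le)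
    have := (tendsto_pow_atTop_atTop_of_one_lt hN1).eventually htail
    filter_upwards [this, eventually_gt_atTop 0] with k hk hk0
    have hk0' : (0:ℝ) < k := by exact_mod_cast hk0
    have hb := h.block (lnn N k) (N ^ k) (N * (√v * √((N ^ k : ℕ) : ℝ))) (lL N k)
    rw [← lnn_succ] at hb
    have h1 : ENNReal.ofReal (1 / (k:ℝ)) ≤ P (s k) := by
      refine le_trans ?_ hb
      refine le_trans ?_ (pow_le_pow_left' hk _)
      rw [← ENNReal.ofReal_pow (exp_pos _).le]
      apply ENNReal.ofReal_le_ofReal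
      rw [← Real.exp_nat_mul]
      change _ ≤ exp (lL N k * (-lkap N))
      rw [one_div, ← Real.exp_log hk0', ← Real.exp_neg, exp_le_exp]
      have := lL_le N k
      rw [le_div_iff₀ hκ] at this
      linarith
    exact (ENNReal.ofReal_le_iff_le_toReal (measure_ne_top _ _)).1 h1
  have hsum : ∑' k, P (s k) = ∞ := by
    by_contra hcon
    have hs1 := ENNReal.summable_toReal hcon
    refine Real.not_summable_one_div_natCast ?_
    refine Summable.of_norm_bounded_eventually_nat hs1 ?_
    filter_upwards [hP] with k hk
    rw [Real.norm_of_nonneg (by positivity)]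
    exact hk
  have hlim := measure_limsup_eq_one hms hind hsum
  have hlim' : ∀ᵐ ω ∂P, ω ∈ limsup s atTop := by
    rw [← prob_compl_eq_zero_iff (MeasurableSet.measurableSet_limsup hms)] at hlim
    exact hlim
  filter_upwards [hlim', h.neg.upper (c := 2) (by norm_num)] with ω hω hup
  rw [mem_limsup_iff_frequently_mem] at hω
  have ht := tendsto_lnn hN
  have ht1 : Tendsto (fun k => lnn N (k + 1)) atTop atTop := ht.comp (tendsto_add_atTop_nat 1)
  refine ht1.frequently ?_
  refine (hω.and_eventually ((ht.eventually hup).and ((key_det hN).and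
    ((tendsto_natCast_atTop_atTop (R := ℝ).comp ht).eventually_ge_atTop (exp 1))))).mono ?_
  rintro k ⟨hk, hk1, hk2, hk3⟩
  simp only [Function.comp] at hk3
  have hk : c k ≤ ∑ i ∈ Finset.Ico (lnn N k) (lnn N (k + 1)), Y i ω := hk
  rw [Finset.sum_neg_distrib] at hk1
  rw [← Finset.sum_range_add_sum_Ico _ (lnn_mono N (Nat.le_succ k))]
  have hφ : lilphi (lnn N k) ≤ lilphi (lnn N (k+1)) / √(N:ℝ) := by
    have hsN : 0 < √(N:ℝ) := Real.sqrt_pos.2 hN0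
    rw [le_div_iff₀ hsN]
    refine abs_le_of_sq_le_sq' ?_ (lilphi_nonneg _) |>.2
    have hle : (lnn N k : ℝ) ≤ lnn N (k+1) := by exact_mod_cast lnn_mono N (Nat.le_succ k)
    have hn0 : 0 < (lnn N k : ℝ) := lt_of_lt_of_le (exp_pos _) hk3
    rw [mul_pow, Real.sq_sqrt hN0.le, lilphi_sq hk3, lilphi_sq (hk3.trans hle)]
    have e1 := one_le_log hk3
    have e2 := Real.log_nonneg e1
    have e3 : log (log (lnn N k : ℝ)) ≤ log (log (lnn N (k+1) : ℝ)) := by gcongr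
    have e4 : (N:ℝ) * lnn N k ≤ lnn N (k+1) := by exact_mod_cast lnn_F2 N k
    calc 2 * (lnn N k : ℝ) * log (log (lnn N k : ℝ)) * N
        = 2 * (N * lnn N k) * log (log (lnn N k : ℝ)) := by ring
      _ ≤ 2 * (lnn N (k+1) : ℝ) * log (log (lnn N (k+1) : ℝ)) := by gcongr
  have hsv : 0 ≤ √v := Real.sqrt_nonneg _
  have m1 := mul_le_mul_of_nonneg_left hk2 hsv
  have m2 := mul_le_mul_of_nonneg_left hφ (show 0 ≤ 2 * √v by positivity)
  have e : c k = √v * (lL N k * (N * √((N ^ k : ℕ) : ℝ))) := by rw [hc]; ring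
  have e' : (√(lG N) - 2 / √(N:ℝ)) * √v * lilphi (lnn N (k+1)) =
    √v * (√(lG N) * lilphi (lnn N (k + 1))) - 2 * √v * (lilphi (lnn N (k+1)) / √(N:ℝ)) := by ring
  rw [e']
  simp only [Nat.succ_eq_add_one] at *
  linarith

lemma lower (h : BddIID P Y B v) {c : ℝ} (hc : c < 1) :
    ∀ᵐ ω ∂P, ∃ᶠ n : ℕ in atTop, c * √v * lilphi n ≤ ∑ i ∈ Finset.range n, Y i ω := by
  obtain ⟨N, hN, hN2⟩ := ((tendsto_lG.eventually (lt_mem_nhds hc)).and (eventually_ge_atTop 2)).exists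
  filter_upwards [h.lower_aux hN2] with ω hω
  refine hω.mono fun n hn => le_trans ?_ hn
  have := lilphi_nonneg n
  gcongr

end BddIID

lemma limsup_eq_of_bounds {u : ℕ → ℝ} {s : ℝ} (h1 : ∀ c > s, ∀ᶠ n in atTop, u n ≤ c)
    (h2 : ∀ c < s, ∃ᶠ n in atTop, c ≤ u n) : limsup u atTop = s := by
  have hb : IsBoundedUnder (· ≤ ·) atTop u :=
    isBoundedUnder_of_eventually_le (h1 (s + 1) (by linarith))
  have hc : IsCoboundedUnder (· ≤ ·) atTop u :=
    IsCoboundedUnder.of_frequently_ge (h2 (s - 1) (by linarith))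
  apply le_antisymm
  · refine le_of_forall_gt_imp_ge_of_dense fun c hc' => limsup_le_of_le hc (h1 c hc')
  · refine le_of_forall_lt_imp_le_of_dense fun c hc' => le_limsup_of_frequently_le (h2 c hc') hb

lemma liminf_eq_of_bounds {u : ℕ → ℝ} {s : ℝ} (h1 : ∀ c < s, ∀ᶠ n in atTop, c ≤ u n)
    (h2 : ∀ c > s, ∃ᶠ n in atTop, u n ≤ c) : liminf u atTop = s := by
  have hb : IsBoundedUnder (· ≥ ·) atTop u :=
    isBoundedUnder_of_eventually_ge (h1 (s - 1) (by linarith))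
  have hc : IsCoboundedUnder (· ≥ ·) atTop u :=
    IsCoboundedUnder.of_frequently_le (h2 (s + 1) (by linarith))
  apply le_antisymm
  · refine le_of_forall_gt_imp_ge_of_dense fun c hc' => liminf_le_of_frequently_le (h2 c hc') hb
  · refine le_of_forall_lt_imp_le_of_dense fun c hc' => le_liminf_of_le hc (h1 c hc')

/-- deterministic transfer -/
lemma det_bounds {T Z φ : ℕ → ℝ} {s K : ℝ} (hs : 0 < s) (hφ : Tendsto φ atTop atTop)
    (hK : ∀ n, |Z n - T n| ≤ K)
    (hup : ∀ j : ℕ, ∀ᶠ n in atTop, T n ≤ (1 + 1 / ((j : ℝ) + 1)) * s * φ n)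
    (hlo : ∀ j : ℕ, ∃ᶠ n in atTop, (1 - 1 / ((j : ℝ) + 1)) * s * φ n ≤ T n) :
    (∀ c > s, ∀ᶠ n in atTop, Z n / φ n ≤ c) ∧ (∀ c < s, ∃ᶠ n in atTop, c ≤ Z n / φ n) := by
  constructor
  · intro c hc
    have hc1 : 0 < c / s - 1 := by rw [sub_pos, lt_div_iff₀ hs]; linarith
    obtain ⟨j, hj⟩ := exists_nat_one_div_lt hc1
    have hd : (1 + 1 / ((j:ℝ) + 1)) * s < c := by
      rw [← lt_div_iff₀ hs]; linarith
    filter_upwards [hup j, hφ.eventually_gt_atTop 0,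
      hφ.eventually_ge_atTop (K / (c - (1 + 1 / ((j:ℝ) + 1)) * s))] with n h1 h2 h3
    rw [div_le_iff₀ h2]
    rw [div_le_iff₀ (by linarith)] at h3
    have := (abs_le.1 (hK n)).2
    nlinarith
  · intro c hc
    have hc1 : 0 < 1 - c / s := by rw [sub_pos, div_lt_iff₀ hs]; linarith
    obtain ⟨j, hj⟩ := exists_nat_one_div_lt hc1
    have hd : c < (1 - 1 / ((j:ℝ) + 1)) * s := by
      rw [← div_lt_iff₀ hs]; linarith
    refine ((hlo j).and_eventually ((hφ.eventually_gt_atTop 0).and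
      (hφ.eventually_ge_atTop (K / ((1 - 1 / ((j:ℝ) + 1)) * s - c))))).mono ?_
    rintro n ⟨h1, h2, h3⟩
    rw [le_div_iff₀ h2]
    rw [div_le_iff₀ (by linarith)] at h3
    have := (abs_le.1 (hK n)).1
    nlinarith

namespace BddIID
variable {Ω : Type*} [MeasurableSpace Ω] {P : Measure Ω} [IsProbabilityMeasure P]
  {Y : ℕ → Ω → ℝ} {B v : ℝ}

lemma lil (h : BddIID P Y B v) {Z : ℕ → Ω → ℝ} {K : ℝ}
    (hK : ∀ᵐ ω ∂P, ∀ n, |Z n ω - ∑ i ∈ Finset.range n, Y i ω| ≤ K) :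
    ∀ᵐ ω ∂P, limsup (fun n : ℕ => Z n ω / √(2 * n * log (log n))) atTop = √v ∧
      liminf (fun n : ℕ => Z n ω / √(2 * n * log (log n))) atTop = -√v := by
  have hs : 0 < √v := Real.sqrt_pos.2 h.vpos
  have hg : ∀ j : ℕ, 0 < 1 / ((j:ℝ) + 1) := fun j => by positivity
  have u1 := ae_all_iff.2 fun j : ℕ => h.upper (c := 1 + 1 / ((j:ℝ) + 1)) (by linarith [hg j])
  have u2 := ae_all_iff.2 fun j : ℕ => h.neg.upper (c := 1 + 1 / ((j:ℝ) + 1)) (by linarith [hg j])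
  have l1 := ae_all_iff.2 fun j : ℕ => h.lower (c := 1 - 1 / ((j:ℝ) + 1)) (by linarith [hg j])
  have l2 := ae_all_iff.2 fun j : ℕ => h.neg.lower (c := 1 - 1 / ((j:ℝ) + 1)) (by linarith [hg j])
  filter_upwards [hK, u1, u2, l1, l2] with ω hK u1 u2 l1 l2
  have d1 := det_bounds hs tendsto_lilphi hK u1 l1
  have hK' : ∀ n, |(-Z n ω) - ∑ i ∈ Finset.range n, -Y i ω| ≤ K := fun n => by
    rw [Finset.sum_neg_distrib, ← neg_sub', abs_neg]; exact hK n
  have d2 := det_bounds hs tendsto_lilphi hK' u2 l2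
  refine ⟨limsup_eq_of_bounds d1.1 d1.2, liminf_eq_of_bounds ?_ ?_⟩
  · intro c hc
    filter_upwards [d2.1 (-c) (by linarith)] with n hn
    rw [neg_div] at hn
    exact neg_le_neg_iff.1 hn
  · intro c hc
    refine (d2.2 (-c) (by linarith)).mono fun n hn => ?_
    rw [neg_div] at hn
    exact neg_le_neg_iff.1 hn

lemma slln (h : BddIID P Y B v) {Z : ℕ → Ω → ℝ} {K : ℝ}
    (hK : ∀ᵐ ω ∂P, ∀ n, |Z n ω - ∑ i ∈ Finset.range n, Y i ω| ≤ K) :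
    ∀ᵐ ω ∂P, Tendsto (fun n : ℕ => Z n ω / n) atTop (𝓝 0) := by
  have := strong_law_ae_real Y (h.integrable_comp 0 (fun x => x) continuous_id)
    (fun i j hij => h.indep.indepFun hij) h.ident
  rw [h.mean] at this
  filter_upwards [this, hK] with ω h1 hK
  have h2 : Tendsto (fun n : ℕ => (Z n ω - ∑ i ∈ Finset.range n, Y i ω) / n) atTop (𝓝 0) := by
    refine squeeze_zero_norm (a := fun n : ℕ => K / n) (fun n => ?_)
      (tendsto_const_div_atTop_nhds_zero_nat K)
    rw [norm_div, Real.norm_eq_abs, RCLike.norm_natCast]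
    exact div_le_div_of_nonneg_right (hK n) (Nat.cast_nonneg n)
  have h3 := h1.add h2
  rw [add_zero] at h3
  refine h3.congr fun n => ?_
  ring

lemma clt (h : BddIID P Y B v) {Z : ℕ → Ω → ℝ} {K : ℝ} (hZ : ∀ n, Measurable (Z n))
    (hK : ∀ᵐ ω ∂P, ∀ n, |Z n ω - ∑ i ∈ Finset.range n, Y i ω| ≤ K)
    (f : BoundedContinuousFunction ℝ ℝ) :
    Tendsto (fun n : ℕ => ∫ ω, f (Z n ω / √n) ∂P) atTop
      (𝓝 (∫ x, f x ∂(gaussianReal 0 v.toNNReal))) := by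
  have hvar : Var[Y 0; P] = v := by
    rw [variance_of_integral_eq_zero (h.meas 0).aemeasurable h.mean, h.var]
  have hL : MemLp (Y 0) 2 P :=
    MemLp.of_bound (h.meas 0).aestronglyMeasurable B (ae_of_all _ fun ω => h.bdd 0 ω)
  have key := tendstoInDistribution_inv_sqrt_mul_sum_sub (P := P)
    (P' := gaussianReal 0 v.toNNReal) (X := Y) (Y := id) (by rw [hvar]; exact HasLaw.id) hL
    h.indep h.ident
  have key2 := tendstoInDistribution_of_tendstoInMeasure_sub (fun (n : ℕ) ω => Z n ω / √n) id key ?_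
    (fun n => ((hZ n).div_const _).aemeasurable)
  · have := ProbabilityMeasure.tendsto_iff_forall_integral_tendsto.1 key2.tendsto f
    simp only [ProbabilityMeasure.coe_mk, Measure.map_id] at this
    refine this.congr fun n => ?_
    rw [integral_map ((hZ n).div_const _).aemeasurable f.continuous.aestronglyMeasurable]
  · refine tendstoInMeasure_of_tendsto_ae ?_ ?_
    · intro n
      exact (((hZ n).div_const _).sub (((h.measurable_sum _).sub_const _).const_mul _)).aestronglyMeasurable
    · filter_upwards [hK] with ω hK
      have hroot : Tendsto (fun n : ℕ => K / √(n:ℝ)) atTop (𝓝 0) :=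
        Tendsto.const_div_atTop (Real.tendsto_sqrt_atTop.comp tendsto_natCast_atTop_atTop) K
      refine squeeze_zero_norm (fun n => ?_) hroot
      simp only [Pi.sub_apply, h.mean, mul_zero, sub_zero, inv_mul_eq_div]
      rw [← sub_div, norm_div, Real.norm_eq_abs, Real.norm_of_nonneg (Real.sqrt_nonneg _)]
      exact div_le_div_of_nonneg_right (hK n) (Real.sqrt_nonneg _)

end BddIID

section
variable {Ω : Type*} [mΩ : MeasurableSpace Ω] {P : Measure Ω} [IsProbabilityMeasure P]
  {X : ℕ → Ω → ℝ}

lemma sigmaUpTo_le (hX : ∀ n, Measurable (X n)) (n : ℕ) : sigmaUpTo X n ≤ mΩ := by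
  unfold sigmaUpTo
  exact Measurable.comap_le (by fun_prop)

lemma measurable_sigmaUpTo {n i : ℕ} (hi : 1 ≤ i) (hin : i ≤ n) :
    Measurable[sigmaUpTo X n] (X i) := by
  have h1 : Measurable[sigmaUpTo X n] (fun ω (k : Fin n) => X ((k : ℕ) + 1) ω) :=
    comap_measurable _
  have h2 := (measurable_pi_apply (⟨i - 1, by omega⟩ : Fin n) (X := fun _ => ℝ)).comp h1
  convert h2 using 1
  ext ω
  simp only [Function.comp]
  congr 1
  omega

lemma cond_step {m : MeasurableSpace Ω} (hm : m ≤ mΩ) {E C : Set Ω} (hE : MeasurableSet[mΩ] E)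
    (hC : MeasurableSet[m] C) {g : Ω → ℝ} {α : ℝ}
    (hg : P[Set.indicator E (fun _ => (1 : ℝ)) | m] =ᵐ[P] g) (hgC : ∀ ω ∈ C, g ω = α) :
    P.real (C ∩ E) = P.real C * α := by
  have hInt : Integrable (Set.indicator E (fun _ => (1 : ℝ))) P :=
    (integrable_const 1).indicator hE
  have h1 := setIntegral_condExp hm hInt hC
  have h2 : ∫ ω in C, (P[Set.indicator E (fun _ => (1 : ℝ)) | m]) ω ∂P = ∫ ω in C, α ∂P := by
    refine setIntegral_congr_ae (hm C hC) ?_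
    filter_upwards [hg] with ω h hω
    rw [h, hgC ω hω]
  rw [h2, setIntegral_const, setIntegral_indicator hE, setIntegral_const] at h1
  simpa using h1.symm

lemma split3 {Z : Ω → ℝ} (hZ : Measurable Z) (hv : ∀ ω, Z ω = 1 ∨ Z ω = -1 ∨ Z ω = 0)
    {C : Set Ω} (hC : MeasurableSet C) {g : Ω → ℝ} (hg : Integrable g P) :
    ∫ ω in C, g ω ∂P = ∫ ω in C ∩ {ω | Z ω = 1}, g ω ∂P + ∫ ω in C ∩ {ω | Z ω = -1}, g ω ∂P
      + ∫ ω in C ∩ {ω | Z ω = 0}, g ω ∂P := by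
  have m1 : ∀ x : ℝ, MeasurableSet (C ∩ {ω | Z ω = x}) := fun x =>
    hC.inter (hZ (measurableSet_singleton x))
  rw [← setIntegral_union _ (m1 (-1)) hg.integrableOn hg.integrableOn,
    ← setIntegral_union _ (m1 0) hg.integrableOn hg.integrableOn]
  · congr 2
    ext ω
    have := hv ω
    simp only [Set.mem_union, Set.mem_inter_iff, Set.mem_ofPred_eq]
    tauto
  · rw [Set.disjoint_left]
    rintro ω (⟨-, h⟩ | ⟨-, h⟩) ⟨-, h'⟩ <;> simp only [Set.mem_ofPred_eq] at h h' <;> linarith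
  · rw [Set.disjoint_left]
    rintro ω ⟨-, h⟩ ⟨-, h'⟩; simp only [Set.mem_ofPred_eq] at h h'; linarith

lemma split3_real {Z : Ω → ℝ} (hZ : Measurable Z) (hv : ∀ ω, Z ω = 1 ∨ Z ω = -1 ∨ Z ω = 0)
    {C : Set Ω} (hC : MeasurableSet C) :
    P.real C = P.real (C ∩ {ω | Z ω = 1}) + P.real (C ∩ {ω | Z ω = -1})
      + P.real (C ∩ {ω | Z ω = 0}) := by
  have := split3 (P := P) hZ hv hC (integrable_const (1:ℝ))
  simpa using this

/-- one step, integrated against a function -/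
lemma step_fun (hX : ∀ n, Measurable (X n))
    (hXval : ∀ n, 1 ≤ n → ∀ ω, X n ω = 1 ∨ X n ω = -1 ∨ X n ω = 0) {n : ℕ}
    {gp gq : Ω → ℝ} {α β : ℝ} {C : Set Ω} (hC : MeasurableSet[sigmaUpTo X n] C)
    (hp : P[Set.indicator {ω | X (n + 1) ω = 1} (fun _ => (1 : ℝ)) | sigmaUpTo X n] =ᵐ[P] gp)
    (hq : P[Set.indicator {ω | X (n + 1) ω = -1} (fun _ => (1 : ℝ)) | sigmaUpTo X n] =ᵐ[P] gq)
    (hgp : ∀ ω ∈ C, gp ω = α) (hgq : ∀ ω ∈ C, gq ω = β) (f : ℝ → ℝ) :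
    ∫ ω in C, f (X (n + 1) ω) ∂P = P.real C * (α * f 1 + β * f (-1) + (1 - α - β) * f 0) := by
  have hC' := sigmaUpTo_le hX n C hC
  have mE : ∀ x : ℝ, MeasurableSet {ω | X (n+1) ω = x} := fun x =>
    hX (n+1) (measurableSet_singleton x)
  have e1 := cond_step (sigmaUpTo_le hX n) (mE 1) hC hp hgp
  have e2 := cond_step (sigmaUpTo_le hX n) (mE (-1)) hC hq hgq
  have e3 := split3_real (P := P) (hX (n+1)) (hXval (n+1) (by omega)) hC'
  have hfun : (fun ω => f (X (n+1) ω)) = fun ω =>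
      (Set.indicator {ω | X (n+1) ω = 1} (fun _ => f 1) ω
      + Set.indicator {ω | X (n+1) ω = -1} (fun _ => f (-1)) ω)
      + Set.indicator {ω | X (n+1) ω = 0} (fun _ => f 0) ω := by
    ext ω
    rcases hXval (n+1) (by omega) ω with h | h | h <;> simp [Set.indicator, h] <;> norm_num
  have hInt : ∀ x c : ℝ, Integrable (Set.indicator {ω | X (n+1) ω = x} (fun _ => c)) (P.restrict C) :=
    fun x c => (integrable_const c).indicator (mE x)
  rw [hfun, integral_add ((hInt _ _).fun_add (hInt _ _)) (hInt _ _), integral_add (hInt _ _) (hInt _ _)]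
  simp only [setIntegral_indicator (mE _), setIntegral_const, smul_eq_mul]
  rw [e1, e2, show P.real (C ∩ {ω | X (n+1) ω = 0}) = P.real C - P.real C * α - P.real C * β by
    linarith]
  ring

lemma cond_real {A : Set Ω} (hA : MeasurableSet A) (B : Set Ω) :
    (P[|A]).real B = (P.real A)⁻¹ * P.real (A ∩ B) := by
  rw [Measure.real, cond_apply hA, ENNReal.toReal_mul, ENNReal.toReal_inv]; rfl

lemma bddiid_of (hX : ∀ n, Measurable (X n))
    (hXval : ∀ n, 1 ≤ n → ∀ ω, X n ω = 1 ∨ X n ω = -1 ∨ X n ω = 0)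
    {gp gq : Ω → ℝ} {α β : ℝ} {A : Set Ω} (hA : MeasurableSet[sigmaUpTo X 2] A) (hPA : P A ≠ 0)
    (hp : ∀ n, 2 ≤ n →
      P[Set.indicator {ω | X (n + 1) ω = 1} (fun _ => (1 : ℝ)) | sigmaUpTo X n] =ᵐ[P] gp)
    (hq : ∀ n, 2 ≤ n →
      P[Set.indicator {ω | X (n + 1) ω = -1} (fun _ => (1 : ℝ)) | sigmaUpTo X n] =ᵐ[P] gq)
    (hgp : ∀ ω ∈ A, gp ω = α) (hgq : ∀ ω ∈ A, gq ω = β)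
    (hα : 0 ≤ α) (hβ : 0 ≤ β) (h0 : 0 < α + β) (h1 : α + β < 1) :
    BddIID (P[|A]) (fun k ω => X (k + 3) ω - (α - β)) 2 (α + β - (α - β) ^ 2) := by
  have hAm := sigmaUpTo_le hX 2 A hA
  have hPr : P.real A ≠ 0 := by
    rw [Measure.real, ENNReal.toReal_ne_zero]; exact ⟨hPA, measure_ne_top _ _⟩
  have : IsProbabilityMeasure (P[|A]) := cond_isProbabilityMeasure hPA
  have hmono : ∀ k, sigmaUpTo X 2 ≤ sigmaUpTo X (k + 2) := by
    intro k
    unfold sigmaUpTo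
    refine (@measurable_iff_comap_le _ _ (sigmaUpTo X (k+2)) _ _).1 ?_
    refine (@measurable_pi_iff _ _ _ (sigmaUpTo X (k+2)) _ _).2 fun i => ?_
    exact measurable_sigmaUpTo (X := X) (n := k + 2) (by omega) (by omega)
  -- key formula
  have key : ∀ k (B : Set Ω), MeasurableSet[sigmaUpTo X (k+2)] B → ∀ f : ℝ → ℝ,
      ∫ ω in B, f (X (k+3) ω) ∂(P[|A]) =
        (P[|A]).real B * (α * f 1 + β * f (-1) + (1 - α - β) * f 0) := by
    intro k B hB f
    have hAB : MeasurableSet[sigmaUpTo X (k+2)] (A ∩ B) := (hmono k A hA).inter hB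
    have hBm := sigmaUpTo_le hX (k+2) B hB
    have := step_fun (n := k + 2) hX hXval hAB (hp _ (by omega)) (hq _ (by omega))
      (fun ω hω => hgp ω hω.1) (fun ω hω => hgq ω hω.1) f
    rw [cond_real hAm, ProbabilityTheory.cond, Measure.restrict_smul,
      Measure.restrict_restrict hBm, integral_smul_measure, Set.inter_comm B A]
    change _ • ∫ ω in A ∩ B, f (X (k + 2 + 1) ω) ∂P = _
    rw [this, ENNReal.toReal_inv, smul_eq_mul]
    simp only [Measure.real]
    ring
  have key0 : ∀ k (f : ℝ → ℝ), ∫ ω, f (X (k+3) ω) ∂(P[|A]) =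
        α * f 1 + β * f (-1) + (1 - α - β) * f 0 := by
    intro k f
    have := key k Set.univ MeasurableSet.univ f
    simpa using this
  have hYm : ∀ k, Measurable (fun ω => X (k + 3) ω - (α - β)) := fun k => (hX _).sub_const _
  have keyS : ∀ k (B : Set Ω), MeasurableSet[sigmaUpTo X (k+2)] B → ∀ s : Set ℝ, MeasurableSet s →
      (P[|A]).real ((fun ω => X (k + 3) ω - (α - β)) ⁻¹' s ∩ B) =
        (P[|A]).real ((fun ω => X (k + 3) ω - (α - β)) ⁻¹' s) * (P[|A]).real B := by
    intro k B hB s hs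
    have hBm := sigmaUpTo_le hX (k+2) B hB
    have a := key k B hB (fun x => s.indicator (fun _ => 1) (x - (α - β)))
    have b := key0 k (fun x => s.indicator (fun _ => 1) (x - (α - β)))
    have e : (fun ω => s.indicator (fun _ => (1:ℝ)) (X (k+3) ω - (α - β))) =
      ((fun ω => X (k + 3) ω - (α - β)) ⁻¹' s).indicator (fun _ => 1) := by
      ext ω; rfl
    rw [← b, e, setIntegral_indicator (hYm k hs), integral_indicator (hYm k hs)] at a
    simp only [setIntegral_const, smul_eq_mul, mul_one] at a
    rw [Set.inter_comm, a, mul_comm]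
  refine ⟨hYm, ?_, ?_, ?_, ?_, ?_, by norm_num, ?_⟩
  · rw [iIndepFun_iff_measure_inter_preimage_eq_mul]
    intro S
    induction S using Finset.induction_on_max with
    | empty => intro sets _; simp
    | insert k S hk ih =>
      intro sets hs
      have hkS : k ∉ S := fun h => lt_irrefl _ (hk k h)
      rw [Finset.prod_insert hkS, ← ih fun i hi => hs i (Finset.mem_insert_of_mem hi),
        Finset.set_biInter_insert]
      have hB : MeasurableSet[sigmaUpTo X (k+2)]
          (⋂ i ∈ S, (fun ω => X (i + 3) ω - (α - β)) ⁻¹' sets i) := by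
        refine MeasurableSet.biInter S.countable_toSet fun i hi => ?_
        have hik := hk i hi
        have : Measurable[sigmaUpTo X (k+2)] (fun ω => X (i + 3) ω - (α - β)) :=
          (measurable_sigmaUpTo (X := X) (n := k + 2) (i := i + 3) (by omega) (by omega)).sub_const _
        exact this (hs i (Finset.mem_insert_of_mem hi))
      have := keyS k _ hB (sets k) (hs k (Finset.mem_insert_self _ _))
      rw [Measure.real, Measure.real, Measure.real, ← ENNReal.toReal_mul,
        ENNReal.toReal_eq_toReal_iff' (measure_ne_top _ _)
          (ENNReal.mul_ne_top (measure_ne_top _ _) (measure_ne_top _ _))] at this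
      exact this
  · intro k
    refine ⟨(hYm k).aemeasurable, (hYm 0).aemeasurable, ?_⟩
    ext s hs
    rw [Measure.map_apply (hYm k) hs, Measure.map_apply (hYm 0) hs]
    have hh : ∀ j, (P[|A]).real ((fun ω => X (j + 3) ω - (α - β)) ⁻¹' s) =
        α * s.indicator (fun _ => 1) (1 - (α - β)) + β * s.indicator (fun _ => 1) (-1 - (α - β))
        + (1 - α - β) * s.indicator (fun _ => 1) (0 - (α - β)) := fun j => by
      have b := key0 j (fun x => s.indicator (fun _ => 1) (x - (α - β)))
      have e : (fun ω => s.indicator (fun _ => (1:ℝ)) (X (j+3) ω - (α - β))) =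
        ((fun ω => X (j + 3) ω - (α - β)) ⁻¹' s).indicator (fun _ => 1) := by
        ext ω; rfl
      rw [e, integral_indicator (hYm j hs)] at b
      simp only [setIntegral_const, smul_eq_mul, mul_one] at b
      exact b
    have := (hh k).trans (hh 0).symm
    rwa [Measure.real, Measure.real, ENNReal.toReal_eq_toReal_iff' (measure_ne_top _ _)
      (measure_ne_top _ _)] at this
  · intro k ω
    rw [abs_le]
    rcases hXval (k + 3) (by omega) ω with h | h | h <;> rw [h] <;> constructor <;> linarith
  · have := key0 0 (fun x => x - (α - β))
    rw [this]; ring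
  · have := key0 0 (fun x => (x - (α - β)) ^ 2)
    rw [this]; ring
  · nlinarith [mul_nonneg hα hβ]

end

section
variable {Ω : Type*} [mΩ : MeasurableSpace Ω] {P : Measure Ω} [IsProbabilityMeasure P]
  {X : ℕ → Ω → ℝ}

lemma sum_telescope (X : ℕ → ℝ) (m : ℝ) (n : ℕ) :
    (∑ k ∈ Finset.Icc 1 n, X k - n * m) - ∑ i ∈ Finset.range n, (X (i + 3) - m) =
      X 1 + X 2 - X (n + 1) - X (n + 2) := by
  induction n with
  | zero => simp
  | succ n ih =>
    rw [Finset.sum_Icc_succ_top (by omega), Finset.sum_range_succ]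
    push_cast
    linarith

lemma ae_of_cond {A : Set Ω} (hA : MeasurableSet A) {Q : Ω → Prop}
    (h : ∀ᵐ ω ∂(P[|A]), Q ω) : ∀ᵐ ω ∂P, ω ∈ A → Q ω := by
  rw [ae_iff, ProbabilityTheory.cond, Measure.smul_apply, smul_eq_mul, mul_eq_zero] at h
  rcases h with h | h
  · exact absurd h (ENNReal.inv_ne_zero.2 (measure_ne_top _ _))
  · exact (ae_restrict_iff' hA).1 (ae_iff.2 h)

lemma case_main (hX : ∀ n, Measurable (X n))
    (hXval : ∀ n, 1 ≤ n → ∀ ω, X n ω = 1 ∨ X n ω = -1 ∨ X n ω = 0)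
    {gp gq : Ω → ℝ} {α β δ a b : ℝ}
    (hp : ∀ n, 2 ≤ n →
      P[Set.indicator {ω | X (n + 1) ω = 1} (fun _ => (1 : ℝ)) | sigmaUpTo X n] =ᵐ[P] gp)
    (hq : ∀ n, 2 ≤ n →
      P[Set.indicator {ω | X (n + 1) ω = -1} (fun _ => (1 : ℝ)) | sigmaUpTo X n] =ᵐ[P] gq)
    (hgp : ∀ ω, X 1 ω = a → X 2 ω = b → gp ω = α) (hgq : ∀ ω, X 1 ω = a → X 2 ω = b → gq ω = β)
    (hα : 0 ≤ α) (hβ : 0 ≤ β) (h0 : 0 < α + β) (h1 : α + β < 1)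
    (hδ : α - β = δ * (a + b) / 2)
    {S : ℕ → Ω → ℝ} (hS : ∀ n ω, S n ω = ∑ k ∈ Finset.Icc 1 n, X k ω) :
    (∀ f : BoundedContinuousFunction ℝ ℝ, Tendsto (fun n : ℕ =>
      ∫ ω in {ω | X 1 ω = a} ∩ {ω | X 2 ω = b},
        f ((S n ω - n * δ * (X 1 ω + X 2 ω) / 2) / √n) ∂P) atTop
        (𝓝 (P.real ({ω | X 1 ω = a} ∩ {ω | X 2 ω = b}) *
          ∫ x, f x ∂(gaussianReal 0 (α + β - (α - β) ^ 2).toNNReal)))) ∧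
    (∀ᵐ ω ∂P, X 1 ω = a → X 2 ω = b →
      Tendsto (fun n : ℕ => (S n ω - n * δ * (X 1 ω + X 2 ω) / 2) / n) atTop (𝓝 0)) ∧
    (∀ᵐ ω ∂P, X 1 ω = a → X 2 ω = b →
      limsup (fun n : ℕ => (S n ω - n * δ * (X 1 ω + X 2 ω) / 2) / √(2 * n * log (log n))) atTop
        = √(α + β - (α - β) ^ 2) ∧
      liminf (fun n : ℕ => (S n ω - n * δ * (X 1 ω + X 2 ω) / 2) / √(2 * n * log (log n))) atTop
        = -√(α + β - (α - β) ^ 2)) := by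
  set A : Set Ω := {ω | X 1 ω = a} ∩ {ω | X 2 ω = b} with hAdef
  have hA2 : MeasurableSet[sigmaUpTo X 2] A :=
    MeasurableSet.inter
      (measurable_sigmaUpTo (X := X) (n := 2) (i := 1) le_rfl (by omega) (measurableSet_singleton a))
      (measurable_sigmaUpTo (X := X) (n := 2) (i := 2) (by omega) le_rfl (measurableSet_singleton b))
  have hA : MeasurableSet A := sigmaUpTo_le hX 2 A hA2
  by_cases hPA : P A = 0
  · have hne : ∀ᵐ ω ∂P, ω ∉ A := measure_eq_zero_iff_ae_notMem.1 hPA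
    refine ⟨fun f => ?_, ?_, ?_⟩
    · rw [Measure.restrict_eq_zero.2 hPA, Measure.real, hPA]
      simp
    · filter_upwards [hne] with ω hω h1 h2
      exact absurd ⟨h1, h2⟩ hω
    · filter_upwards [hne] with ω hω h1 h2
      exact absurd ⟨h1, h2⟩ hω
  have hB := bddiid_of hX hXval hA2 hPA hp hq (fun ω hω => hgp ω hω.1 hω.2)
    (fun ω hω => hgq ω hω.1 hω.2) hα hβ h0 h1
  have : IsProbabilityMeasure (P[|A]) := cond_isProbabilityMeasure hPA
  have hPr : P.real A ≠ 0 := by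
    rw [Measure.real, ENNReal.toReal_ne_zero]; exact ⟨hPA, measure_ne_top _ _⟩
  set Z : ℕ → Ω → ℝ := fun n ω => S n ω - n * (α - β) with hZ
  have hSm : ∀ n, Measurable (S n) := fun n => by
    have : S n = fun ω => ∑ k ∈ Finset.Icc 1 n, X k ω := funext (hS n)
    rw [this]
    exact Finset.measurable_sum _ fun i _ => hX i
  have hZm : ∀ n, Measurable (Z n) := fun n => (hSm n).sub_const _
  have hX1 : ∀ n, 1 ≤ n → ∀ ω, |X n ω| ≤ 1 := fun n hn ω => by
    rcases hXval n hn ω with h | h | h <;> rw [h] <;> norm_num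
  have hK : ∀ᵐ ω ∂(P[|A]), ∀ n, |Z n ω - ∑ i ∈ Finset.range n, (X (i + 3) ω - (α - β))| ≤ 4 := by
    refine ae_of_all _ fun ω n => ?_
    have := sum_telescope (fun k => X k ω) (α - β) n
    simp only [hZ, hS]
    rw [this]
    have a1 := abs_le.1 (hX1 1 le_rfl ω)
    have a2 := abs_le.1 (hX1 2 (by omega) ω)
    have a3 := abs_le.1 (hX1 (n+1) (by omega) ω)
    have a4 := abs_le.1 (hX1 (n+2) (by omega) ω)
    rw [abs_le]; constructor <;> linarith
  have hWZ : ∀ ω ∈ A, ∀ n : ℕ, S n ω - n * δ * (X 1 ω + X 2 ω) / 2 = Z n ω := by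
    intro ω hω n
    have e1 : X 1 ω = a := hω.1
    have e2 : X 2 ω = b := hω.2
    simp only [hZ]
    rw [e1, e2, hδ]; ring
  refine ⟨fun f => ?_, ?_, ?_⟩
  · have hc := (hB.clt hZm hK f).const_mul (P.real A)
    refine hc.congr fun n => ?_
    rw [ProbabilityTheory.cond, integral_smul_measure, ENNReal.toReal_inv, smul_eq_mul]
    change P.real A * ((P.real A)⁻¹ * _) = _
    rw [mul_inv_cancel_left₀ hPr]
    refine setIntegral_congr_fun hA fun ω hω => ?_
    rw [hWZ ω hω]
  · filter_upwards [ae_of_cond hA (hB.slln hK)] with ω hω h1 h2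
    have hωA : ω ∈ A := ⟨h1, h2⟩
    simp only [hWZ ω hωA]
    exact hω hωA
  · filter_upwards [ae_of_cond hA (hB.lil hK)] with ω hω h1 h2
    have hωA : ω ∈ A := ⟨h1, h2⟩
    simp only [hWZ ω hωA]
    exact hω hωA

end

/-- for the ERWD remembering only the first two steps, with
`σ²(x₁,x₂) = (p+q)(x₁²+x₂²)/2 − ((p−q)(x₁+x₂)/2)²`:
(a) `(Sₙ − n(p−q)(X₁+X₂)/2)/√n` converges in distribution to the mixture
`p(p+q)·N(0, p+q−(p−q)²) + r(p+q)·N(0, (p+q)/2−((p−q)/2)²) + q(p+q)·N(0, p+q) + r·δ₀`;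
(b) `(Sₙ − n(p−q)(X₁+X₂)/2)/n → 0` a.s.;
(c) on `{X₁² + X₂² ≠ 0}`, the LIL holds with constant `σ(X₁,X₂)`. -/
theorem erwd_first_two_steps_memory_random_normalization
    {Ω : Type*} [MeasurableSpace Ω] (P : Measure Ω) [IsProbabilityMeasure P]
    (p q r : ℝ) (hp : 0 < p) (hp1 : p < 1) (hq : 0 < q) (hq1 : q < 1)
    (hr : 0 < r) (hr1 : r < 1) (hpqr : p + q + r = 1)
    (X : ℕ → Ω → ℝ) (hXmeas : ∀ n, Measurable (X n))
    (hXval : ∀ n, 1 ≤ n → ∀ ω, X n ω = 1 ∨ X n ω = -1 ∨ X n ω = 0)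
    (hX1p : P {ω | X 1 ω = 1} = ENNReal.ofReal p)
    (hX1q : P {ω | X 1 ω = -1} = ENNReal.ofReal q)
    (hX1r : P {ω | X 1 ω = 0} = ENNReal.ofReal r)
    (hX2p : P[Set.indicator {ω | X 2 ω = 1} (fun _ => (1 : ℝ)) | sigmaUpTo X 1]
      =ᵐ[P] fun ω =>
        p * (if X 1 ω = 1 then (1 : ℝ) else 0) + q * (if X 1 ω = -1 then (1 : ℝ) else 0))
    (hX2q : P[Set.indicator {ω | X 2 ω = -1} (fun _ => (1 : ℝ)) | sigmaUpTo X 1]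
      =ᵐ[P] fun ω =>
        q * (if X 1 ω = 1 then (1 : ℝ) else 0) + p * (if X 1 ω = -1 then (1 : ℝ) else 0))
    (hcondp : ∀ n : ℕ, 2 ≤ n →
      P[Set.indicator {ω | X (n + 1) ω = 1} (fun _ => (1 : ℝ)) | sigmaUpTo X n]
        =ᵐ[P] fun ω =>
          (p * ((if X 1 ω = 1 then (1 : ℝ) else 0) + (if X 2 ω = 1 then (1 : ℝ) else 0))
            + q * ((if X 1 ω = -1 then (1 : ℝ) else 0)
              + (if X 2 ω = -1 then (1 : ℝ) else 0))) / 2)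
    (hcondq : ∀ n : ℕ, 2 ≤ n →
      P[Set.indicator {ω | X (n + 1) ω = -1} (fun _ => (1 : ℝ)) | sigmaUpTo X n]
        =ᵐ[P] fun ω =>
          (q * ((if X 1 ω = 1 then (1 : ℝ) else 0) + (if X 2 ω = 1 then (1 : ℝ) else 0))
            + p * ((if X 1 ω = -1 then (1 : ℝ) else 0)
              + (if X 2 ω = -1 then (1 : ℝ) else 0))) / 2)
    (S : ℕ → Ω → ℝ) (hS : ∀ n ω, S n ω = ∑ k ∈ Finset.Icc 1 n, X k ω)
    (σsq : ℝ → ℝ → ℝ)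
    (hσsq : ∀ x₁ x₂, σsq x₁ x₂
      = (p + q) * (x₁ ^ 2 + x₂ ^ 2) / 2 - ((p - q) * (x₁ + x₂) / 2) ^ 2) :
    TendstoInDist
      (fun n : ℕ =>
        Measure.map
          (fun ω => (S n ω - n * (p - q) * (X 1 ω + X 2 ω) / 2) / Real.sqrt n) P)
      (ENNReal.ofReal (p * (p + q)) •
          gaussianReal 0 (Real.toNNReal (p + q - (p - q) ^ 2))
        + ENNReal.ofReal (r * (p + q)) •
          gaussianReal 0 (Real.toNNReal ((p + q) / 2 - ((p - q) / 2) ^ 2))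
        + ENNReal.ofReal (q * (p + q)) • gaussianReal 0 (Real.toNNReal (p + q))
        + ENNReal.ofReal r • Measure.dirac 0) ∧
    (∀ᵐ ω ∂P,
      Tendsto (fun n : ℕ => (S n ω - n * (p - q) * (X 1 ω + X 2 ω) / 2) / n)
        atTop (𝓝 0)) ∧
    (∀ᵐ ω ∂P, (X 1 ω) ^ 2 + (X 2 ω) ^ 2 ≠ 0 →
      Filter.limsup
          (fun n : ℕ => (S n ω - n * (p - q) * (X 1 ω + X 2 ω) / 2) /
            Real.sqrt (2 * n * Real.log (Real.log n))) atTop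
        = Real.sqrt (σsq (X 1 ω) (X 2 ω)) ∧
      Filter.liminf
          (fun n : ℕ => (S n ω - n * (p - q) * (X 1 ω + X 2 ω) / 2) /
            Real.sqrt (2 * n * Real.log (Real.log n))) atTop
        = -Real.sqrt (σsq (X 1 ω) (X 2 ω))) := by
  set gp : Ω → ℝ := fun ω =>
          (p * ((if X 1 ω = 1 then (1 : ℝ) else 0) + (if X 2 ω = 1 then (1 : ℝ) else 0))
            + q * ((if X 1 ω = -1 then (1 : ℝ) else 0)
              + (if X 2 ω = -1 then (1 : ℝ) else 0))) / 2 with hgp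
  set gq : Ω → ℝ := fun ω =>
          (q * ((if X 1 ω = 1 then (1 : ℝ) else 0) + (if X 2 ω = 1 then (1 : ℝ) else 0))
            + p * ((if X 1 ω = -1 then (1 : ℝ) else 0)
              + (if X 2 ω = -1 then (1 : ℝ) else 0))) / 2 with hgq
  have c11 := case_main (α := p) (β := q) (δ := p - q) (a := 1) (b := 1) hXmeas hXval hcondp hcondq
    (fun ω h1 h2 => by simp only [hgp, h1, h2]; norm_num)
    (fun ω h1 h2 => by simp only [hgq, h1, h2]; norm_num)
    (by linarith) (by linarith) (by linarith) (by linarith) (by ring) hS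
  have cmm := case_main (α := q) (β := p) (δ := p - q) (a := -1) (b := -1) hXmeas hXval hcondp hcondq
    (fun ω h1 h2 => by simp only [hgp, h1, h2]; norm_num)
    (fun ω h1 h2 => by simp only [hgq, h1, h2]; norm_num)
    (by linarith) (by linarith) (by linarith) (by linarith) (by ring) hS
  have c10 := case_main (α := p / 2) (β := q / 2) (δ := p - q) (a := 1) (b := 0) hXmeas hXval
    hcondp hcondq
    (fun ω h1 h2 => by simp only [hgp, h1, h2]; norm_num)
    (fun ω h1 h2 => by simp only [hgq, h1, h2]; norm_num)
    (by linarith) (by linarith) (by linarith) (by linarith) (by ring) hS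
  have cm0 := case_main (α := q / 2) (β := p / 2) (δ := p - q) (a := -1) (b := 0) hXmeas hXval
    hcondp hcondq
    (fun ω h1 h2 => by simp only [hgp, h1, h2]; norm_num)
    (fun ω h1 h2 => by simp only [hgq, h1, h2]; norm_num)
    (by linarith) (by linarith) (by linarith) (by linarith) (by ring) hS
  have c1m := case_main (α := (p + q) / 2) (β := (p + q) / 2) (δ := p - q) (a := 1) (b := -1)
    hXmeas hXval hcondp hcondq
    (fun ω h1 h2 => by simp only [hgp, h1, h2]; norm_num)
    (fun ω h1 h2 => by simp only [hgq, h1, h2]; norm_num; ring)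
    (by linarith) (by linarith) (by linarith) (by linarith) (by ring) hS
  have cm1 := case_main (α := (p + q) / 2) (β := (p + q) / 2) (δ := p - q) (a := -1) (b := 1)
    hXmeas hXval hcondp hcondq
    (fun ω h1 h2 => by simp only [hgp, h1, h2]; norm_num)
    (fun ω h1 h2 => by simp only [hgq, h1, h2]; norm_num; ring)
    (by linarith) (by linarith) (by linarith) (by linarith) (by ring) hS
  -- probabilities
  have mE : ∀ (n : ℕ) (x : ℝ), MeasurableSet {ω | X n ω = x} := fun n x =>
    hXmeas n (measurableSet_singleton x)
  have mE1 : ∀ x : ℝ, MeasurableSet[sigmaUpTo X 1] {ω | X 1 ω = x} := fun x =>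
    measurable_sigmaUpTo (X := X) (n := 1) (i := 1) le_rfl le_rfl (measurableSet_singleton x)
  have r1 : P.real {ω | X 1 ω = 1} = p := by rw [Measure.real, hX1p, ENNReal.toReal_ofReal hp.le]
  have rm : P.real {ω | X 1 ω = -1} = q := by rw [Measure.real, hX1q, ENNReal.toReal_ofReal hq.le]
  have r0 : P.real {ω | X 1 ω = 0} = r := by rw [Measure.real, hX1r, ENNReal.toReal_ofReal hr.le]
  have hle1 := sigmaUpTo_le hXmeas 1
  have P11 := cond_step (α := p) hle1 (mE 2 1) (mE1 1) hX2p (fun ω (hω : X 1 ω = 1) => by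
    rw [hω]; norm_num)
  have Pm1 := cond_step (α := q) hle1 (mE 2 1) (mE1 (-1)) hX2p (fun ω (hω : X 1 ω = -1) => by
    rw [hω]; norm_num)
  have P01 := cond_step (α := 0) hle1 (mE 2 1) (mE1 0) hX2p (fun ω (hω : X 1 ω = 0) => by
    rw [hω]; norm_num)
  have P1m := cond_step (α := q) hle1 (mE 2 (-1)) (mE1 1) hX2q (fun ω (hω : X 1 ω = 1) => by
    rw [hω]; norm_num)
  have Pmm := cond_step (α := p) hle1 (mE 2 (-1)) (mE1 (-1)) hX2q (fun ω (hω : X 1 ω = -1) => by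
    rw [hω]; norm_num)
  have P0m := cond_step (α := 0) hle1 (mE 2 (-1)) (mE1 0) hX2q (fun ω (hω : X 1 ω = 0) => by
    rw [hω]; norm_num)
  have P10 : P.real ({ω | X 1 ω = 1} ∩ {ω | X 2 ω = 0}) = p * r := by
    have := split3_real (P := P) (hXmeas 2) (hXval 2 (by omega)) (mE 1 1)
    rw [P11, P1m, r1] at this
    have hr' : r = 1 - p - q := by linarith
    rw [hr']; linarith
  have Pm0 : P.real ({ω | X 1 ω = -1} ∩ {ω | X 2 ω = 0}) = q * r := by
    have := split3_real (P := P) (hXmeas 2) (hXval 2 (by omega)) (mE 1 (-1))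
    rw [Pm1, Pmm, rm] at this
    have hr' : r = 1 - p - q := by linarith
    rw [hr']; linarith
  rw [r1] at P11 P1m
  rw [rm] at Pm1 Pmm
  -- null case
  have hnull : ∀ {s : Set Ω}, P.real s = 0 → ∀ᵐ ω ∂P, ω ∉ s := fun {s} hs => by
    rw [← measure_eq_zero_iff_ae_notMem]
    exact (measureReal_eq_zero_iff (measure_ne_top _ _)).1 hs
  have z2 : ∀ᵐ ω ∂P, X 1 ω = 0 → X 2 ω = 0 := by
    filter_upwards [hnull (P01.trans (mul_zero _)), hnull (P0m.trans (mul_zero _))] with ω h1 h2 h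
    rcases hXval 2 (by omega) ω with h' | h' | h'
    · exact absurd ⟨h, h'⟩ h1
    · exact absurd ⟨h, h'⟩ h2
    · exact h'
  have z3 : ∀ᵐ ω ∂P, ∀ n, 2 ≤ n → X 1 ω = 0 → X 2 ω = 0 → X (n + 1) ω = 0 := by
    rw [ae_all_iff]
    intro n
    by_cases hn : 2 ≤ n
    swap
    · exact ae_of_all _ fun ω h => absurd h hn
    have hC : MeasurableSet[sigmaUpTo X n] ({ω | X 1 ω = 0} ∩ {ω | X 2 ω = 0}) :=
      MeasurableSet.inter
        (measurable_sigmaUpTo (X := X) (n := n) (i := 1) le_rfl (by omega)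
          (measurableSet_singleton 0))
        (measurable_sigmaUpTo (X := X) (n := n) (i := 2) (by omega) hn
          (measurableSet_singleton 0))
    have e1 := cond_step (α := 0) (sigmaUpTo_le hXmeas n) (mE (n+1) 1) hC (hcondp n hn)
      (fun ω hω => by
        have h1 : X 1 ω = 0 := hω.1
        have h2 : X 2 ω = 0 := hω.2
        simp only [hgp, h1, h2]; norm_num)
    have e2 := cond_step (α := 0) (sigmaUpTo_le hXmeas n) (mE (n+1) (-1)) hC (hcondq n hn)
      (fun ω hω => by
        have h1 : X 1 ω = 0 := hω.1
        have h2 : X 2 ω = 0 := hω.2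
        simp only [hgq, h1, h2]; norm_num)
    filter_upwards [hnull (e1.trans (mul_zero _)), hnull (e2.trans (mul_zero _))]
      with ω h1 h2 _ h h''
    rcases hXval (n+1) (by omega) ω with h' | h' | h'
    · exact absurd ⟨⟨h, h''⟩, h'⟩ h1
    · exact absurd ⟨⟨h, h''⟩, h'⟩ h2
    · exact h'
  have zW : ∀ᵐ ω ∂P, X 1 ω = 0 → ∀ n : ℕ, S n ω - n * (p - q) * (X 1 ω + X 2 ω) / 2 = 0 := by
    filter_upwards [z2, z3] with ω h2 h3 h1 n
    have h2' := h2 h1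
    have hall : ∀ k, 1 ≤ k → X k ω = 0 := by
      intro k hk
      rcases Nat.lt_or_ge k 3 with hk3 | hk3
      · interval_cases k <;> assumption
      · obtain ⟨j, rfl⟩ : ∃ j, k = j + 1 := ⟨k - 1, by omega⟩
        exact h3 j (by omega) h1 h2'
    rw [hS, Finset.sum_eq_zero fun k hk => hall k (Finset.mem_Icc.1 hk).1, h1, h2']
    ring
  have hSm : ∀ n, Measurable (S n) := fun n => by
    have : S n = fun ω => ∑ k ∈ Finset.Icc 1 n, X k ω := funext (hS n)
    rw [this]
    exact Finset.measurable_sum _ fun i _ => hXmeas i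
  refine ⟨?_, ?_, ?_⟩
  · intro f
    have hWm : ∀ n : ℕ, Measurable
        (fun ω => (S n ω - n * (p - q) * (X 1 ω + X 2 ω) / 2) / Real.sqrt n) := fun n =>
      ((hSm n).sub ((((hXmeas 1).add (hXmeas 2)).const_mul _).div_const _)).div_const _
    have hInt : ∀ n : ℕ, Integrable
        (fun ω => f ((S n ω - n * (p - q) * (X 1 ω + X 2 ω) / 2) / Real.sqrt n)) P := fun n =>
      Integrable.of_bound (f.continuous.measurable.comp (hWm n)).aestronglyMeasurable ‖f‖
        (ae_of_all _ fun ω => f.norm_coe_le_norm _)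
    have hzero : ∀ n : ℕ, ∫ ω in {ω | X 1 ω = 0},
        f ((S n ω - n * (p - q) * (X 1 ω + X 2 ω) / 2) / Real.sqrt n) ∂P = r * f 0 := by
      intro n
      have : ∫ ω in {ω | X 1 ω = 0},
        f ((S n ω - n * (p - q) * (X 1 ω + X 2 ω) / 2) / Real.sqrt n) ∂P =
          ∫ ω in {ω | X 1 ω = 0}, f 0 ∂P := by
        refine setIntegral_congr_ae (mE 1 0) ?_
        filter_upwards [zW] with ω h hω
        rw [h hω n, zero_div]
      rw [this, setIntegral_const, r0, smul_eq_mul]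
    have hlim := ((((c11.1 f).add (c1m.1 f)).add (c10.1 f)).add
      (((cm1.1 f).add (cmm.1 f)).add (cm0.1 f))).add
      (tendsto_const_nhds (x := r * f 0) (f := (atTop : Filter ℕ)))
    convert hlim using 2
    · rename_i n
      rw [integral_map (hWm n).aemeasurable f.continuous.aestronglyMeasurable,
        ← setIntegral_univ, split3 (hXmeas 1) (hXval 1 le_rfl) MeasurableSet.univ (hInt n)]
      simp only [Set.univ_inter]
      rw [hzero n, split3 (hXmeas 2) (hXval 2 (by omega)) (mE 1 1) (hInt n),
        split3 (hXmeas 2) (hXval 2 (by omega)) (mE 1 (-1)) (hInt n)]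
    have hfi : ∀ (μ : Measure ℝ) [IsFiniteMeasure μ], Integrable (fun x => f x) μ :=
      fun μ _ => f.integrable μ
    have hfs : ∀ (c : ℝ) (μ : Measure ℝ) [IsFiniteMeasure μ],
        Integrable (fun x => f x) (ENNReal.ofReal c • μ) :=
      fun c μ _ => (f.integrable μ).smul_measure ENNReal.ofReal_ne_top
    rw [integral_add_measure (((hfs _ _).add_measure (hfs _ _)).add_measure (hfs _ _)) (hfs _ _),
      integral_add_measure ((hfs _ _).add_measure (hfs _ _)) (hfs _ _),
      integral_add_measure (hfs _ _) (hfs _ _)]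
    simp only [integral_smul_measure, integral_dirac, smul_eq_mul]
    rw [ENNReal.toReal_ofReal (by positivity), ENNReal.toReal_ofReal (by positivity),
      ENNReal.toReal_ofReal (by positivity), ENNReal.toReal_ofReal hr.le,
      P11, P1m, P10, Pm1, Pmm, Pm0]
    rw [show q + p - (q - p) ^ 2 = p + q - (p - q) ^ 2 by ring,
      show p / 2 + q / 2 - (p / 2 - q / 2) ^ 2 = (p + q) / 2 - ((p - q) / 2) ^ 2 by ring,
      show q / 2 + p / 2 - (q / 2 - p / 2) ^ 2 = (p + q) / 2 - ((p - q) / 2) ^ 2 by ring,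
      show (p + q) / 2 + (p + q) / 2 - ((p + q) / 2 - (p + q) / 2) ^ 2 = p + q by ring]
    ring
  · filter_upwards [c11.2.1, cmm.2.1, c10.2.1, cm0.2.1, c1m.2.1, cm1.2.1, zW]
      with ω d1 d2 d3 d4 d5 d6 d7
    rcases hXval 1 le_rfl ω with h | h | h
    · rcases hXval 2 (by omega) ω with h' | h' | h'
      · exact d1 h h'
      · exact d5 h h'
      · exact d3 h h'
    · rcases hXval 2 (by omega) ω with h' | h' | h'
      · exact d6 h h'
      · exact d2 h h'
      · exact d4 h h'
    · simp only [d7 h, zero_div]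
      exact tendsto_const_nhds
  · filter_upwards [c11.2.2, cmm.2.2, c10.2.2, cm0.2.2, c1m.2.2, cm1.2.2, z2]
      with ω d1 d2 d3 d4 d5 d6 d7 hne
    have key : ∀ {v : ℝ}, σsq (X 1 ω) (X 2 ω) = v → (limsup (fun n : ℕ =>
        (S n ω - n * (p - q) * (X 1 ω + X 2 ω) / 2) / √(2 * n * log (log n))) atTop = √v ∧
        liminf (fun n : ℕ =>
        (S n ω - n * (p - q) * (X 1 ω + X 2 ω) / 2) / √(2 * n * log (log n))) atTop = -√v) →
        (limsup (fun n : ℕ => (S n ω - n * (p - q) * (X 1 ω + X 2 ω) / 2) /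
          √(2 * n * log (log n))) atTop = √(σsq (X 1 ω) (X 2 ω)) ∧
        liminf (fun n : ℕ => (S n ω - n * (p - q) * (X 1 ω + X 2 ω) / 2) /
          √(2 * n * log (log n))) atTop = -√(σsq (X 1 ω) (X 2 ω))) := by
      intro v hv h
      rw [hv]; exact h
    rcases hXval 1 le_rfl ω with h | h | h
    · rcases hXval 2 (by omega) ω with h' | h' | h'
      · exact key (by rw [hσsq, h, h']; ring) (d1 h h')
      · exact key (by rw [hσsq, h, h']; ring) (d5 h h')
      · exact key (by rw [hσsq, h, h']; ring) (d3 h h')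
    · rcases hXval 2 (by omega) ω with h' | h' | h'
      · exact key (by rw [hσsq, h, h']; ring) (d6 h h')
      · exact key (by rw [hσsq, h, h']; ring) (d2 h h')
      · exact key (by rw [hσsq, h, h']; ring) (d4 h h')
    · exact absurd (by rw [h, d7 h]; norm_num) hne
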